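/- For every r-colored composition (α,ε) of n, the virtual character Σ_{(β,δ) ⪯ (α,ε)} (-1)^{ℓ(α) - ℓ(β)} Ind_{S_{β,r}}^{S_{n,r}} 1_{(β,δ)} of the colored permutation group S_{n,r} is a genuine (non-virtual) character, equal to Σ_{𝛌 ⊢ n} c_𝛌(α,ε) χ^𝛌, where χ^𝛌 denotes the irreducible character of S_{n,r} indexed by the r-partite partition 𝛌 and c_𝛌(α,ε) is the number of standard Young r-partite tableaux of shape 𝛌 with colored descent composition (α,ε). -/

import Mathlib

/-- The extended color vector of a colored composition: each color is repeated
as many times as the size of its part. -/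
def colorWord {r : ℕ} (l : List (ℕ × Fin r)) : List (Fin r) :=
  (l.map fun p => List.replicate p.1 p.2).flatten

/-- The set of partial sums of a colored composition, excluding the total sum
(the colored subset of `[n-1]` corresponding to `l`, forgetting colors). -/
def cInnerSums {r : ℕ} (l : List (ℕ × Fin r)) : Set ℕ :=
  {m | ∃ k, k + 1 < l.length ∧ m = ((l.take (k + 1)).map Prod.fst).sum}

/-- The reverse refinement order on `r`-colored compositions, in which only
consecutive parts of equal color may be merged: `b ⪯ a` iff `a` and `b` have
the same extended color vector and the partial-sum set of `b` is contained in
that of `a`. -/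
def coarserC {r : ℕ} (b a : List (ℕ × Fin r)) : Prop :=
  colorWord b = colorWord a ∧ cInnerSums b ⊆ cInnerSums a
/-- `T` is a standard Young `r`-partite tableau of the `r`-partite shape `sh`
with `n` cells in total: each part is zero off its shape, entries are in
`{1, …, n}`, every element of `{1, …, n}` appears exactly once in exactly one
part, and each part increases along rows and down columns. -/
def IsPartiteSYT {r : ℕ} (sh : Fin r → Finset (ℤ × ℤ)) (n : ℕ)
    (T : Fin r → ℤ × ℤ → ℕ) : Prop :=
  (∀ j, ∀ c ∉ sh j, T j c = 0) ∧
  (∀ j, ∀ c ∈ sh j, T j c ∈ Finset.Icc 1 n) ∧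
  (∀ m ∈ Finset.Icc 1 n, ∃! p : Fin r × (ℤ × ℤ), p.2 ∈ sh p.1 ∧ T p.1 p.2 = m) ∧
  (∀ j, ∀ c ∈ sh j, (c.1, c.2 + 1) ∈ sh j → T j c < T j (c.1, c.2 + 1)) ∧
  (∀ j, ∀ c ∈ sh j, (c.1 + 1, c.2) ∈ sh j → T j c < T j (c.1 + 1, c.2))
open Classical in
/-- The color of the part of the `r`-partite tableau `T` containing the entry
`m` (and `0` if there is no such part). -/
noncomputable def tabColor {r : ℕ} [NeZero r] (sh : Fin r → Finset (ℤ × ℤ))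
    (T : Fin r → ℤ × ℤ → ℕ) (m : ℕ) : Fin r :=
  if h : ∃ p : Fin r × (ℤ × ℤ), p.2 ∈ sh p.1 ∧ T p.1 p.2 = m then
    (Classical.choose h).1
  else 0

open Classical in
/-- The set `S⁺ = S ∪ {n}` underlying the colored descent set of an
`r`-partite tableau `T` with entries `1, …, n`. -/
noncomputable def sDesPlusTab {r : ℕ} (sh : Fin r → Finset (ℤ × ℤ)) (n : ℕ)
    (T : Fin r → ℤ × ℤ → ℕ) : Finset ℕ :=
  (Finset.Icc 1 n).filter fun i =>
    i = n ∨ ∃ j, ∃ c ∈ sh j, ∃ j', ∃ c' ∈ sh j',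
      T j c = i ∧ T j' c' = i + 1 ∧ (j ≠ j' ∨ c.1 < c'.1)

/-- The colored descent composition `co(Q)` of an `r`-partite tableau: the
colored composition whose parts are the successive differences of the elements
of `S⁺ = sDes(Q) ∪ {n}` and whose colors are the colors of the parts containing
those entries. -/
noncomputable def coTab {r : ℕ} [NeZero r] (sh : Fin r → Finset (ℤ × ℤ))
    (n : ℕ) (T : Fin r → ℤ × ℤ → ℕ) : List (ℕ × Fin r) :=
  let L := (sDesPlusTab sh n T).sort (· ≤ ·)
  (List.range L.length).map fun k =>
    (L.getD k 0 - (if k = 0 then 0 else L.getD (k - 1) 0),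
      tabColor sh T (L.getD k 0))

/-- The `r`-partite shape (in `ℤ × ℤ` cells) of an `r`-partite partition,
given as a tuple of Young diagrams. -/
def shOf {r : ℕ} (lam : Fin r → YoungDiagram) : Fin r → Finset (ℤ × ℤ) :=
  fun j => (lam j).cells.image fun c => ((c.1 : ℤ), (c.2 : ℤ))
/-- The action of `S_n` on color vectors: `π` sends `z` to `z ∘ π⁻¹`. -/
def permAct (n r : ℕ) :
    Equiv.Perm (Fin n) →* MulAut (Fin n → Multiplicative (ZMod r)) where
  toFun π := MulEquiv.arrowCongr π (MulEquiv.refl (Multiplicative (ZMod r)))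
  map_one' := by ext z i; rfl
  map_mul' a b := by ext z i; rfl

/-- The `r`-colored permutation group `S_{n,r} = ℤ_r ≀ S_n`, realized as the
semidirect product of the group of color vectors by `S_n`:  the element with
`left = z` and `right = π` represents the colored permutation `(π, z)`. -/
abbrev Gnr (n r : ℕ) :=
  SemidirectProduct (Fin n → Multiplicative (ZMod r)) (Equiv.Perm (Fin n)) (permAct n r)

/-- `Gnr n r` is in bijection with pairs. -/
def gnrEquiv (n r : ℕ) :
    Gnr n r ≃ (Fin n → Multiplicative (ZMod r)) × Equiv.Perm (Fin n) where
  toFun w := (w.left, w.right)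
  invFun p := ⟨p.1, p.2⟩
  left_inv w := rfl
  right_inv p := rfl

noncomputable instance (n r : ℕ) [NeZero r] : Fintype (Gnr n r) :=
  Fintype.ofEquiv _ (gnrEquiv n r).symm

/-- The index of the block of the composition with parts `β` containing the
(0-indexed) position `i`: the number of partial sums of `β` that are `≤ i`. -/
def blk (β : List ℕ) (i : ℕ) : ℕ :=
  ((List.range β.length).filter fun k => decide ((β.take (k + 1)).sum ≤ i)).length

/-- The Young subgroup `S_{β,r} = S_{β₁,r} × S_{β₂,r} × ⋯` of `S_{n,r}`,
consisting of the colored permutations whose underlying permutation preserves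
each block of `β`. -/
def youngSet (n r : ℕ) (β : List ℕ) : Set (Gnr n r) :=
  {w | ∀ i : Fin n, blk β (w.right i) = blk β i}

/-- A fixed primitive `r`-th root of unity. -/
noncomputable def omega (r : ℕ) : ℂ := Complex.exp (2 * Real.pi * Complex.I / r)

/-- The one-dimensional character `1_{(β,δ)} = 1_{β₁,δ₁} ⊗ ⋯ ⊗ 1_{β_k,δ_k}` of
the Young subgroup `S_{β,r}` associated with the colored composition `b`
(extended to a function on all of `S_{n,r}`): its value on `(π, z)` is
`ω^{Σ_i δ_{blk(i)} z_i}`. -/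
noncomputable def oneChar (n r : ℕ) [NeZero r] (b : List (ℕ × Fin r)) :
    Gnr n r → ℂ := fun w =>
  omega r ^
    ∑ i : Fin n,
      ((b.getD (blk (b.map Prod.fst) i) (1, 0)).2 : ℕ) *
        (Multiplicative.toAdd (w.left i)).val

open Classical in
/-- The induced class function `Ind_H^G χ` of a function `χ : G → ℂ`
supported on a subgroup `H` (given as a set):
`Ind_H^G χ(g) = |H|⁻¹ Σ_{x ∈ G} χ°(x⁻¹ g x)`. -/
noncomputable def inducedChar {G : Type*} [Group G] [Fintype G] (H : Set G)
    (χ : G → ℂ) : G → ℂ := fun g =>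
  (Nat.card H : ℂ)⁻¹ * ∑ x : G, if x⁻¹ * g * x ∈ H then χ (x⁻¹ * g * x) else 0

/-- The list of signed entries `λ^{(j)}_i + σ_j(i) - i` (0-indexed rows) of the
Jacobi–Trudi expansion of the `r`-partite partition `lam` at the tuple of
permutations `σ`, with their colors. -/
def jtList {r : ℕ} (lam : Fin r → YoungDiagram)
    (σ : ∀ j : Fin r, Equiv.Perm (Fin ((lam j).colLen 0))) :
    List (ℤ × Fin r) :=
  ((List.finRange r).map fun j =>
    (List.finRange ((lam j).colLen 0)).map fun i : Fin ((lam j).colLen 0) =>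
      ((((lam j).rowLen (i : ℕ) : ℤ) + ((σ j i : ℕ) : ℤ) - ((i : ℕ) : ℤ)), j)).flatten

/-- The irreducible character `χ^𝛌` of `S_{n,r}` indexed by the `r`-partite
partition `𝛌`, defined via the Jacobi–Trudi alternating sum
`χ^𝛌 = Σ_σ (Π_j sgn σ_j) · Ind_{S_{β(σ),r}}^{S_{n,r}} 1_{(β(σ),δ(σ))}`, whose
Frobenius image is `Π_j det(h_{λ^{(j)}_i - i + t}(x^{(j)})) = s_𝛌`. -/
noncomputable def irrChar (n r : ℕ) [NeZero r] (lam : Fin r → YoungDiagram) :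
    Gnr n r → ℂ :=
  ∑ σ : ∀ j : Fin r, Equiv.Perm (Fin ((lam j).colLen 0)),
    if ∀ p ∈ jtList lam σ, 0 ≤ p.1 then
      (∏ j, ((Equiv.Perm.sign (σ j) : ℤˣ) : ℤ)) •
        inducedChar
          (youngSet n r
            (((jtList lam σ).filter fun p => decide (p.1 ≠ 0)).map fun p => p.1.toNat))
          (oneChar n r
            (((jtList lam σ).filter fun p => decide (p.1 ≠ 0)).map fun p =>
              (p.1.toNat, p.2)))
    else 0

/-- The Jacobi–Trudi determinant `det (h (μ i - i + t))` of size `N`. -/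
def jtDet {R : Type*} [CommRing R] (h : ℤ → R) {N : ℕ} (μ : Fin N → ℕ) : R :=
  Matrix.det (Matrix.of fun i t : Fin N => h ((μ i : ℤ) - (i : ℕ) + (t : ℕ)))

theorem det_of_last_row {R : Type*} [CommRing R] {N : ℕ}
    (A : Matrix (Fin (N + 1)) (Fin (N + 1)) R)
    (hA : ∀ t : Fin N, A (Fin.last N) t.castSucc = 0) :
    A.det = A (Fin.last N) (Fin.last N) * (A.submatrix Fin.castSucc Fin.castSucc).det := by
  rw [Matrix.det_succ_row A (Fin.last N), Fin.sum_univ_castSucc]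
  simp [hA, ← two_mul, pow_mul]

theorem jtDet_succ {R : Type*} [CommRing R] (h : ℤ → R) (h0 : h 0 = 1)
    (hneg : ∀ k < 0, h k = 0) {N : ℕ} (μ : Fin (N + 1) → ℕ) (hμ : μ (Fin.last N) = 0) :
    jtDet h μ = jtDet h (fun i : Fin N => μ i.castSucc) := by
  rw [jtDet, det_of_last_row]
  · simp [hμ, h0, jtDet, Matrix.submatrix]
  · intro t
    simp only [Matrix.of_apply, hμ]
    exact hneg _ (by simp)

theorem jtDet_stable {R : Type*} [CommRing R] (h : ℤ → R) (h0 : h 0 = 1)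
    (hneg : ∀ k < 0, h k = 0) (μ : ℕ → ℕ) {M N : ℕ} (hMN : M ≤ N) (hμ : ∀ i, M ≤ i → μ i = 0) :
    jtDet h (fun i : Fin N => μ i) = jtDet h (fun i : Fin M => μ i) := by
  induction N, hMN using Nat.le_induction with
  | base => rfl
  | succ N hN ih => rw [jtDet_succ h h0 hneg _ (by simpa using hμ N hN), ← ih]; rfl

open PowerSeries in
/-- The generating series `∑ a, h (k + a) X ^ a`. -/
def tailSeries {R : Type*} [CommRing R] (h : ℤ → R) (k : ℤ) : PowerSeries R :=
  PowerSeries.mk fun a => h (k + a)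

theorem tailSeries_eq {R : Type*} [CommRing R] (h : ℤ → R) (k : ℤ) (c : ℕ) :
    tailSeries h k = ∑ a ∈ Finset.range c, PowerSeries.X ^ a * PowerSeries.C (h (k + a)) +
      PowerSeries.X ^ c * tailSeries h (k + c) := by
  ext m
  simp only [tailSeries, PowerSeries.coeff_mk, map_add, map_sum, PowerSeries.coeff_X_pow_mul',
    PowerSeries.coeff_C]
  by_cases hm : c ≤ m
  · rw [Finset.sum_eq_zero, if_pos hm, zero_add]
    · congr 1; push_cast [hm]; ring
    · intro a ha
      have := Finset.mem_range.1 ha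
      split_ifs <;> first | rfl | omega
  · rw [if_neg hm, Finset.sum_eq_single m]
    · simp
    · intro a _ ha
      split_ifs <;> first | rfl | omega
    · intro h; simp at h; omega

/-- The exponent vectors `a` of total size `m` such that adding `a i` boxes to each row `i` of `μ`
yields a horizontal strip. -/
def strips {N : ℕ} (m : ℕ) (μ : Fin (N + 1) → ℕ) : Finset (Fin (N + 1) → ℕ) :=
  (Fintype.piFinset (Fin.cases (Finset.range (m + 1))
    fun i : Fin N => Finset.range (μ i.castSucc - μ i.succ + 1))).filter fun a => ∑ i, a i = m

theorem mem_strips {N : ℕ} (m : ℕ) (μ : Fin (N + 1) → ℕ)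
    (hμ : ∀ i : Fin N, μ i.succ ≤ μ i.castSucc) (a : Fin (N + 1) → ℕ) :
    a ∈ strips m μ ↔ ∑ i, a i = m ∧ ∀ i : Fin N, μ i.succ + a i.succ ≤ μ i.castSucc := by
  simp only [strips, Finset.mem_filter, Fintype.mem_piFinset]
  constructor
  · rintro ⟨h, hs⟩
    refine ⟨hs, fun i => ?_⟩
    have := h i.succ
    simp at this
    have := hμ i
    omega
  · rintro ⟨hs, h⟩
    refine ⟨fun i => ?_, hs⟩
    refine Fin.cases ?_ (fun i => ?_) i
    · have : a 0 ≤ ∑ i, a i := Finset.single_le_sum (fun _ _ => Nat.zero_le _) (Finset.mem_univ _)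
      simp; omega
    · have := h i
      simp; omega

theorem det_tailSeries_last {R : Type*} [CommRing R] (h : ℤ → R) (h0 : h 0 = 1)
    (hneg : ∀ k < 0, h k = 0) {N : ℕ} (μ : Fin (N + 1) → ℕ) (hμ : μ (Fin.last N) = 0) :
    (Matrix.of fun i t : Fin (N + 1) => tailSeries h ((μ i : ℤ) - (i : ℕ) + (t : ℕ))).det =
      tailSeries h 0 * PowerSeries.C (jtDet h μ) := by
  set B : Matrix (Fin (N + 1)) (Fin (N + 1)) (PowerSeries R) :=
    Matrix.of fun i t : Fin (N + 1) => if t = Fin.last N then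
      tailSeries h ((μ i : ℤ) - (i : ℕ) + (t : ℕ)) else
      PowerSeries.C (h ((μ i : ℤ) - (i : ℕ) + (t : ℕ))) with hB
  have h1 : (Matrix.of fun i t : Fin (N + 1) =>
      tailSeries h ((μ i : ℤ) - (i : ℕ) + (t : ℕ))).det = B.det := by
    set A := (Matrix.of fun i t : Fin (N + 1) =>
      tailSeries h ((μ i : ℤ) - (i : ℕ) + (t : ℕ))) with hA
    have key : (A.submatrix id (Fin.revPerm : Equiv.Perm _)).det =
        (B.submatrix id (Fin.revPerm : Equiv.Perm _)).det := by
      refine Matrix.det_eq_of_forall_col_eq_smul_add_pred (fun _ => PowerSeries.X) ?_ ?_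
      · intro i
        simp [hA, hB]
      · intro i j
        have hj : (Fin.rev j.succ) ≠ Fin.last N := by
          rw [← Fin.rev_zero, Ne, Fin.rev_inj]; exact Fin.succ_ne_zero j
        simp only [hA, hB, Matrix.submatrix_apply, Matrix.of_apply, id, Fin.revPerm_apply, if_neg hj]
        rw [tailSeries_eq h _ 1]
        simp only [Finset.sum_range_one, pow_zero, one_mul, Nat.cast_zero, add_zero, pow_one]
        congr 3
        have := j.isLt
        simp only [Fin.val_rev, Fin.val_succ, Fin.val_castSucc]
        omega
    rw [Matrix.det_permute', Matrix.det_permute'] at key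
    rcases Int.units_eq_one_or (Equiv.Perm.sign (Fin.revPerm : Equiv.Perm (Fin (N + 1)))) with hs | hs
    · simpa [hs] using key
    · simpa [hs] using key
  rw [h1, det_of_last_row]
  · rw [jtDet, RingHom.map_det, det_of_last_row (RingHom.mapMatrix _ _)]
    · simp only [hB, RingHom.mapMatrix_apply, Matrix.map_apply, Matrix.of_apply, if_true, hμ]
      simp only [Nat.cast_zero, zero_sub, Fin.val_last, neg_add_cancel, h0, map_one, one_mul]
      congr 2
      ext1 i t
      simp [(Fin.castSucc_lt_last t).ne]
    · intro t
      simp only [RingHom.mapMatrix_apply, Matrix.map_apply, Matrix.of_apply, hμ]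
      rw [hneg _ (by simp), map_zero]
  · intro t
    simp only [hB, Matrix.of_apply, if_neg (Fin.castSucc_lt_last t).ne, hμ]
    rw [hneg _ (by simp), map_zero]

/-- Pieri's rule for Jacobi–Trudi determinants. -/
theorem jtDet_pieri {R : Type*} [CommRing R] (h : ℤ → R) (h0 : h 0 = 1)
    (hneg : ∀ k < 0, h k = 0) {N : ℕ} (μ : Fin (N + 1) → ℕ) (hμ : μ (Fin.last N) = 0)
    (hanti : ∀ i : Fin N, μ i.succ ≤ μ i.castSucc) (m : ℕ) :
    h m * jtDet h μ = ∑ a ∈ strips m μ, jtDet h (μ + a) := by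
  set bd : Fin (N + 1) → Finset ℕ := Fin.cases (Finset.range (m + 1))
    fun i : Fin N => Finset.range (μ i.castSucc - μ i.succ + 1) with hbd
  set P : Matrix (Fin (N + 1)) (Fin (N + 1)) (PowerSeries R) :=
    Matrix.of fun i t => ∑ a ∈ bd i, PowerSeries.X ^ a *
      PowerSeries.C (h ((μ i : ℤ) - (i : ℕ) + (t : ℕ) + (a : ℕ))) with hP
  set B : Matrix (Fin (N + 1)) (Fin (N + 1)) (PowerSeries R) :=
    Matrix.of fun i t => P i t + if i = 0 then PowerSeries.X ^ (m + 1) *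
      tailSeries h ((μ i : ℤ) - (i : ℕ) + (t : ℕ) + (m + 1 : ℕ)) else 0 with hB
  have h1 : (Matrix.of fun i t : Fin (N + 1) =>
      tailSeries h ((μ i : ℤ) - (i : ℕ) + (t : ℕ))).det = B.det := by
    refine Matrix.det_eq_of_forall_row_eq_smul_add_pred
      (fun i => PowerSeries.X ^ (μ i.castSucc - μ i.succ + 1)) ?_ ?_
    · intro t
      simp only [Matrix.of_apply, hB, hP, hbd, Fin.cases_zero, if_true]
      exact tailSeries_eq h _ (m + 1)
    · intro i t
      simp only [Matrix.of_apply, hB, hP, hbd, Fin.cases_succ, if_neg (Fin.succ_ne_zero i), add_zero]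
      rw [tailSeries_eq h _ (μ i.castSucc - μ i.succ + 1)]
      congr 3
      have := hanti i
      push_cast [this]
      simp
      ring
  have h2 : PowerSeries.X ^ (m + 1) ∣ B.det - P.det := by
    rw [← Ideal.mem_span_singleton, ← Ideal.Quotient.eq, RingHom.map_det, RingHom.map_det]
    congr 1
    ext i t
    simp only [RingHom.mapMatrix_apply, Matrix.map_apply]
    rw [Ideal.Quotient.eq, Ideal.mem_span_singleton]
    simp only [hB, Matrix.of_apply, add_sub_cancel_left]
    split_ifs <;> simp
  have h3 := PowerSeries.X_pow_dvd_iff.1 h2 m (Nat.lt_succ_self m)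
  rw [map_sub, sub_eq_zero, ← h1, det_tailSeries_last h h0 hneg μ hμ] at h3
  have h4 : h m * jtDet h μ =
      PowerSeries.coeff m (tailSeries h 0 * PowerSeries.C (jtDet h μ)) := by
    rw [PowerSeries.coeff_mul_C]
    simp [tailSeries]
  have h5 : P.det = ∑ a ∈ Fintype.piFinset bd,
      PowerSeries.X ^ (∑ i, a i) * PowerSeries.C (jtDet h (μ + a)) := by
    have hPf : P = fun i => ∑ a ∈ bd i, fun t : Fin (N + 1) => PowerSeries.X ^ a *
      PowerSeries.C (h ((μ i : ℤ) - (i : ℕ) + (t : ℕ) + (a : ℕ))) := by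
      funext i t
      simp [hP]
    have := (Matrix.detRowAlternating (n := Fin (N + 1)) (R := PowerSeries R)).toMultilinearMap.map_sum_finset
      (fun i a => fun t : Fin (N + 1) => PowerSeries.X ^ a *
      PowerSeries.C (h ((μ i : ℤ) - (i : ℕ) + (t : ℕ) + (a : ℕ)))) bd
    rw [← hPf] at this
    refine Eq.trans this (Finset.sum_congr rfl fun a _ => ?_)
    rw [jtDet, RingHom.map_det, ← Finset.prod_pow_eq_pow_sum, ← Matrix.det_mul_column]
    refine congrArg Matrix.det ?_
    ext1 i t
    simp only [Matrix.of_apply, RingHom.mapMatrix_apply, Matrix.map_apply, Pi.add_apply]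
    congr 3
    push_cast
    ring
  rw [h4, h3, h5, map_sum, strips, Finset.sum_filter]
  refine Finset.sum_congr rfl fun a _ => ?_
  rw [PowerSeries.coeff_X_pow_mul', PowerSeries.coeff_C]
  split_ifs <;> first | rfl | omega

/-- A word of letters (color, row), read from its last letter, is a lattice word if adding the
corresponding boxes one at a time (starting from the last letter) always gives partitions. -/
def IsLatticeWord {r : ℕ} : List (Fin r × ℕ) → Prop
  | [] => True
  | x :: w => IsLatticeWord w ∧ (x.2 = 0 ∨ w.count x < w.count (x.1, x.2 - 1))

/-- Whether the letter `x` following `y` creates a descent. -/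
def IsWordDesc {r : ℕ} (y x : Fin r × ℕ) : Prop := x.1 ≠ y.1 ∨ y.2 < x.2

instance {r : ℕ} (y x : Fin r × ℕ) : Decidable (IsWordDesc y x) :=
  inferInstanceAs (Decidable (_ ∨ _))

/-- Adds `m` to the first part of a colored composition. -/
def bumpHead {r : ℕ} (m : ℕ) : List (ℕ × Fin r) → List (ℕ × Fin r)
  | [] => []
  | p :: L => (m + p.1, p.2) :: L

/-- The reversed colored descent composition of a reversed word. -/
def wordComp {r : ℕ} : List (Fin r × ℕ) → List (ℕ × Fin r)
  | [] => []
  | [x] => [(1, x.1)]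
  | x :: y :: w => if IsWordDesc y x then (1, x.1) :: wordComp (y :: w)
      else bumpHead 1 (wordComp (y :: w))

theorem IsLatticeWord.count_succ_le {r : ℕ} {w : List (Fin r × ℕ)} (hw : IsLatticeWord w)
    (j : Fin r) (i : ℕ) : w.count (j, i + 1) ≤ w.count (j, i) := by
  induction w with
  | nil => simp
  | cons x w ih =>
    obtain ⟨hw, hx⟩ := hw
    have := ih hw
    simp only [List.count_cons, beq_iff_eq]
    by_cases h : x = (j, i + 1)
    · subst h
      simp at hx ⊢
      omega
    · rw [if_neg h]; omega

theorem IsLatticeWord.row_lt {r : ℕ} {w : List (Fin r × ℕ)} (hw : IsLatticeWord w)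
    {x : Fin r × ℕ} (hx : x ∈ w) : x.2 < w.length := by
  induction w generalizing x with
  | nil => simp at hx
  | cons y w ih =>
    obtain ⟨hw, hy⟩ := hw
    rcases List.mem_cons.1 hx with rfl | hx
    · rcases hy with hy | hy
      · simp [hy]
      · have := ih hw (List.count_pos_iff.1 (Nat.zero_lt_of_lt hy))
        simp at this ⊢; omega
    · have := ih hw hx
      simp; omega

theorem IsLatticeWord.of_append {r : ℕ} {u w : List (Fin r × ℕ)} (h : IsLatticeWord (u ++ w)) :
    IsLatticeWord w := by
  induction u with
  | nil => exact h
  | cons x u ih => exact ih h.1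

/-- A word of color `j` whose rows weakly increase (in reversed reading). -/
def IsStripWord {r : ℕ} (j : Fin r) (u : List (Fin r × ℕ)) : Prop :=
  (∀ x ∈ u, x.1 = j) ∧ u.Pairwise fun x y => x.2 ≤ y.2

theorem isLatticeWord_append_iff {r : ℕ} {j : Fin r} {u w : List (Fin r × ℕ)}
    (hu : IsStripWord j u) (hw : IsLatticeWord w) :
    IsLatticeWord (u ++ w) ↔
      ∀ i, w.count (j, i + 1) + u.count (j, i + 1) ≤ w.count (j, i) := by
  induction u with
  | nil => simpa [hw] using fun i => hw.count_succ_le j i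
  | cons x u ih =>
    obtain ⟨hc, hp⟩ := hu
    obtain ⟨hx, hpu⟩ := List.pairwise_cons.1 hp
    obtain ⟨j', k⟩ := x
    obtain rfl : j' = j := hc (j', k) (by simp)
    have ih := ih ⟨fun y hy => hc y (by simp [hy]), hpu⟩
    simp only [List.cons_append, IsLatticeWord, ih, List.count_append, List.count_cons, beq_iff_eq,
      Prod.mk.injEq, true_and]
    have h0 : k ≠ 0 → u.count (j', k - 1) = 0 := by
      intro hk
      rw [List.count_eq_zero]
      intro hm
      have := hx _ hm
      simp at this; omega
    constructor
    · rintro ⟨h1, h2⟩ i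
      have := h1 i
      split_ifs with hi
      · subst hi
        have := h0 (by omega)
        simp at h2 this
        omega
      · omega
    · intro h
      refine ⟨fun i => by have := h i; omega, ?_⟩
      by_cases hk : k = 0
      · exact Or.inl hk
      · right
        obtain ⟨i, rfl⟩ := Nat.exists_eq_succ_of_ne_zero hk
        have := h i
        have := h0 hk
        simp at this h ⊢
        have := h i
        simp at this
        omega

theorem wordComp_pos {r : ℕ} (w : List (Fin r × ℕ)) : ∀ p ∈ wordComp w, 0 < p.1 := by
  induction w using wordComp.induct with
  | case1 => simp [wordComp]
  | case2 x => simp [wordComp]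
  | case3 x y w h ih => simpa [wordComp, h] using ih
  | case4 x y w h ih =>
    rw [wordComp, if_neg h]
    generalize wordComp (y :: w) = L at ih
    cases L with
    | nil => simp [bumpHead]
    | cons p L =>
      simp [bumpHead] at ih ⊢
      exact ih.2

theorem exists_wordComp_cons {r : ℕ} (x : Fin r × ℕ) (w : List (Fin r × ℕ)) :
    ∃ m L, wordComp (x :: w) = (m, x.1) :: L := by
  induction w generalizing x with
  | nil => exact ⟨1, [], rfl⟩
  | cons y w ih =>
    obtain ⟨m, L, h⟩ := ih y
    rw [wordComp, h]
    split_ifs with hd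
    · exact ⟨_, _, rfl⟩
    · have : x.1 = y.1 := by simp [IsWordDesc] at hd; exact hd.1
      exact ⟨1 + m, L, by rw [bumpHead, this]⟩

theorem wordComp_sum {r : ℕ} (w : List (Fin r × ℕ)) :
    ((wordComp w).map Prod.fst).sum = w.length := by
  induction w using wordComp.induct with
  | case1 => simp [wordComp]
  | case2 x => simp [wordComp]
  | case3 x y w h ih => simp [wordComp, h, ih]; omega
  | case4 x y w h ih =>
    obtain ⟨m, L, h'⟩ := exists_wordComp_cons y w
    rw [wordComp, if_neg h]
    rw [h'] at ih ⊢
    simp [bumpHead] at ih ⊢; omega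

theorem wordComp_eq_nil {r : ℕ} {w : List (Fin r × ℕ)} : wordComp w = [] ↔ w = [] := by
  cases w with
  | nil => simp [wordComp]
  | cons x w =>
    obtain ⟨m, L, h'⟩ := exists_wordComp_cons x w
    simp [h']

theorem wordComp_append {r : ℕ} {j : Fin r} {u w : List (Fin r × ℕ)} (hu : IsStripWord j u)
    (hne : u ≠ []) :
    wordComp (u ++ w) = (u.length, j) :: wordComp w ∨
      ∃ q L, wordComp w = (q, j) :: L ∧ wordComp (u ++ w) = (u.length + q, j) :: L := by
  induction u with
  | nil => exact absurd rfl hne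
  | cons x u ih =>
    obtain ⟨hc, hp⟩ := hu
    obtain ⟨hx, hp⟩ := List.pairwise_cons.1 hp
    have hxj : x.1 = j := hc x (by simp)
    cases u with
    | nil =>
      cases w with
      | nil => left; simp [wordComp, hxj]
      | cons y w =>
        simp only [List.cons_append, List.nil_append, wordComp]
        split_ifs with hd
        · left; simp [hxj]
        · right
          obtain ⟨m, L, h⟩ := exists_wordComp_cons y w
          have : y.1 = j := by simp [IsWordDesc] at hd; rw [← hd.1, hxj]
          exact ⟨m, L, by rw [h, this], by rw [h, bumpHead, this]; simp⟩
    | cons y u =>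
      have hd : ¬ IsWordDesc y x := by
        have hy := hx y (by simp)
        have := hc y (by simp)
        simp [IsWordDesc, hxj, this, hy]
      simp only [List.cons_append, wordComp, if_neg hd]
      rcases ih ⟨fun z hz => hc z (by simp [hz]), hp⟩ (by simp) with h | ⟨q, L, h1, h2⟩
      · left
        rw [List.cons_append] at h
        rw [h, bumpHead]; simp; omega
      · right
        rw [List.cons_append] at h2
        refine ⟨q, L, h1, ?_⟩
        rw [h2, bumpHead]; simp; omega

theorem wordComp_take_drop {r : ℕ} {j : Fin r} (m q : ℕ) (L : List (ℕ × Fin r))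
    (w : List (Fin r × ℕ)) (h : wordComp w = (m + 1 + q, j) :: L) :
    IsStripWord j (w.take (m + 1)) ∧ (w.drop (m + 1)).length + (m + 1) = w.length ∧
      wordComp (w.drop (m + 1)) = if q = 0 then L else (q, j) :: L := by
  induction m generalizing w with
  | zero =>
    cases w with
    | nil => simp [wordComp] at h
    | cons x w =>
      obtain ⟨m, L', h'⟩ := exists_wordComp_cons x w
      have hxj : x.1 = j := by simp [h'] at h; exact h.1.2
      refine ⟨by simp [IsStripWord, hxj], by simp, ?_⟩
      simp only [zero_add, List.drop_one, List.tail_cons]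
      cases w with
      | nil =>
        simp [wordComp] at h
        simp [wordComp, h]
      | cons y w =>
        rw [wordComp] at h
        split_ifs at h with hd
        · simp at h
          simp [h]
        · obtain ⟨m', L'', h''⟩ := exists_wordComp_cons y w
          have hpos := wordComp_pos (y :: w)
          rw [h''] at h hpos ⊢
          simp [bumpHead] at h hpos
          obtain ⟨⟨h1, h2⟩, rfl⟩ := h
          rw [if_neg (by omega), h1, h2]
  | succ m ih =>
    cases w with
    | nil => simp [wordComp] at h
    | cons x w =>
      obtain ⟨m', L', h'⟩ := exists_wordComp_cons x w
      have hxj : x.1 = j := by simp [h'] at h; exact h.1.2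
      cases w with
      | nil =>
        simp [wordComp] at h
        omega
      | cons y w =>
        rw [wordComp] at h
        split_ifs at h with hd
        · simp at h; omega
        · obtain ⟨m', L'', h''⟩ := exists_wordComp_cons y w
          have hw : wordComp (y :: w) = (m + 1 + q, j) :: L := by
            rw [h''] at h ⊢
            simp [bumpHead] at h ⊢
            refine ⟨⟨by omega, h.1.2⟩, h.2⟩
          obtain ⟨⟨hc, hp⟩, h2, h3⟩ := ih (y :: w) hw
          refine ⟨⟨?_, ?_⟩, ?_, ?_⟩
          · intro z hz
            rw [List.take_succ_cons, List.mem_cons] at hz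
            rcases hz with rfl | hz
            · exact hxj
            · exact hc z hz
          · rw [List.take_succ_cons]
            refine List.pairwise_cons.2 ⟨?_, hp⟩
            intro z hz
            have hxy : x.2 ≤ y.2 := by simp [IsWordDesc] at hd; exact hd.2
            rw [List.take_succ_cons] at hz hp
            rcases List.mem_cons.1 hz with rfl | hz
            · exact hxy
            · exact hxy.trans ((List.pairwise_cons.1 hp).1 z hz)
          · rw [List.drop_succ_cons, List.length_cons (a := x), ← h2]; omega
          · rw [List.drop_succ_cons, h3]

theorem finite_latticeWords (r n : ℕ) :
    {w : List (Fin r × ℕ) | IsLatticeWord w ∧ w.length = n}.Finite := by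
  induction n with
  | zero => exact (Set.finite_singleton []).subset fun w hw => by simpa using hw.2
  | succ n ih =>
    refine (Set.Finite.image2 List.cons
      (Set.finite_univ.prod (Set.finite_Iio (n + 1)) : (Set.univ ×ˢ Set.Iio (n + 1) :
        Set (Fin r × ℕ)).Finite) ih).subset ?_
    rintro w ⟨hw, hl⟩
    cases w with
    | nil => simp at hl
    | cons x w =>
      have := hw.row_lt (x := x) (by simp)
      exact ⟨x, by simpa [← hl] using this, w, ⟨hw.1, by simpa using hl⟩, rfl⟩

theorem finite_compWords {r : ℕ} (L : List (ℕ × Fin r)) :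
    {w : List (Fin r × ℕ) | IsLatticeWord w ∧ wordComp w = L}.Finite := by
  refine (finite_latticeWords r (L.map Prod.fst).sum).subset ?_
  rintro w ⟨hw, rfl⟩
  exact ⟨hw, (wordComp_sum w).symm⟩

/-- The lattice words with reversed colored descent composition `L`. -/
noncomputable def compWords {r : ℕ} (L : List (ℕ × Fin r)) : Finset (List (Fin r × ℕ)) :=
  (finite_compWords L).toFinset

theorem mem_compWords {r : ℕ} {L : List (ℕ × Fin r)} {w : List (Fin r × ℕ)} :
    w ∈ compWords L ↔ IsLatticeWord w ∧ wordComp w = L := by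
  simp [compWords]

theorem length_of_mem_compWords {r : ℕ} {L : List (ℕ × Fin r)} {w : List (Fin r × ℕ)}
    (hw : w ∈ compWords L) : w.length = (L.map Prod.fst).sum := by
  rw [← (mem_compWords.1 hw).2, wordComp_sum]

/-- The product over the colors of the Jacobi–Trudi determinants of the shape of the word `w`. -/
def wordSchur {R : Type*} [CommRing R] {r : ℕ} (h : Fin r → ℤ → R) (N : ℕ)
    (w : List (Fin r × ℕ)) : R :=
  ∏ j, jtDet (h j) fun i : Fin N => w.count (j, (i : ℕ))

theorem IsStripWord.eq_of_count {r : ℕ} {j : Fin r} {u u' : List (Fin r × ℕ)}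
    (hu : IsStripWord j u) (hu' : IsStripWord j u')
    (h : ∀ i, u.count (j, i) = u'.count (j, i)) : u = u' := by
  have key : ∀ (v v' : List (Fin r × ℕ)), IsStripWord j v → IsStripWord j v' →
      ∀ x ∈ v, ∀ y ∈ v', x.2 ≤ y.2 → y.2 ≤ x.2 → x = y := by
    intro v v' hv hv' x hx y hy h1 h2
    exact Prod.ext ((hv.1 x hx).trans (hv'.1 y hy).symm) (le_antisymm h1 h2)
  refine List.Perm.eq_of_pairwise (le := fun x y : Fin r × ℕ => x.2 ≤ y.2)
    (fun x y hx hy => key u u' hu hu' x hx y hy) hu.2 hu'.2 (List.perm_iff_count.2 ?_)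
  rintro ⟨j', i⟩
  by_cases hj : j' = j
  · rw [hj, h]
  · rw [List.count_eq_zero.2 fun hm => hj (hu.1 _ hm), List.count_eq_zero.2 fun hm => hj (hu'.1 _ hm)]

theorem exists_stripWord {r : ℕ} (j : Fin r) {N : ℕ} (a : Fin N → ℕ) :
    ∃ u : List (Fin r × ℕ), IsStripWord j u ∧ u.length = ∑ i, a i ∧
      (∀ i : Fin N, u.count (j, (i : ℕ)) = a i) ∧ ∀ i, N ≤ i → u.count (j, i) = 0 := by
  induction N with
  | zero => exact ⟨[], by simp [IsStripWord]⟩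
  | succ N ih =>
    obtain ⟨u, ⟨hc, hp⟩, hl, h1, h2⟩ := ih fun i => a i.castSucc
    refine ⟨u ++ List.replicate (a (Fin.last N)) (j, N), ⟨?_, ?_⟩, ?_, ?_, ?_⟩
    · intro x hx
      rcases List.mem_append.1 hx with hx | hx
      · exact hc x hx
      · rw [List.eq_of_mem_replicate hx]
    · rw [List.pairwise_append]
      refine ⟨hp, List.pairwise_replicate.2 (Or.inr le_rfl), ?_⟩
      intro x hx y hy
      rw [List.eq_of_mem_replicate hy]
      by_contra hlt
      have := h2 x.2 (by simp at hlt; omega)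
      rw [List.count_eq_zero] at this
      exact this (by rw [← hc x hx]; exact hx)
    · simp [hl, Fin.sum_univ_castSucc]
    · intro i
      rw [List.count_append, List.count_replicate]
      refine Fin.lastCases ?_ (fun i => ?_) i
      · simp [h2 N le_rfl]
      · rw [Fin.val_castSucc, h1 i, if_neg (by have := i.isLt; simp; omega)]; simp
    · intro i hi
      rw [List.count_append, List.count_replicate, h2 i (by omega), if_neg (by simp; omega)]

/-- The lattice words obtained from a word of reversed colored descent composition `L` by adding
a horizontal strip of `m` boxes of color `j`. -/
theorem finite_stripExtensions {r : ℕ} (L : List (ℕ × Fin r)) (m : ℕ) (j : Fin r) :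
    {w : List (Fin r × ℕ) | IsLatticeWord w ∧ IsStripWord j (w.take m) ∧
      (w.drop m).length + m = w.length ∧ wordComp (w.drop m) = L}.Finite := by
  refine (finite_latticeWords r ((L.map Prod.fst).sum + m)).subset ?_
  rintro w ⟨hw, -, h, rfl⟩
  exact ⟨hw, by rw [wordComp_sum, h]⟩

theorem mul_sum_compWords {R : Type*} [CommRing R] {r : ℕ} (h : Fin r → ℤ → R)
    (h0 : ∀ j, h j 0 = 1) (hneg : ∀ j, ∀ k < 0, h j k = 0) (L : List (ℕ × Fin r)) (m : ℕ)
    (j : Fin r) {N : ℕ} (hm : 0 < m) (hN : (L.map Prod.fst).sum + m ≤ N + 1) :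
    h j m * ∑ w ∈ compWords L, wordSchur h (N + 1) w =
      ∑ w ∈ (finite_stripExtensions L m j).toFinset, wordSchur h (N + 1) w := by
  have hpieri : ∀ w ∈ compWords L, h j m * wordSchur h (N + 1) w =
      ∑ a ∈ strips m (fun i : Fin (N + 1) => w.count (j, (i : ℕ))),
        jtDet (h j) ((fun i : Fin (N + 1) => w.count (j, (i : ℕ))) + a) *
        ∏ j' ∈ Finset.univ.erase j, jtDet (h j') fun i : Fin (N + 1) => w.count (j', (i : ℕ)) := by
    intro w hw
    have hl := length_of_mem_compWords hw
    have hw := (mem_compWords.1 hw).1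
    rw [wordSchur, ← Finset.mul_prod_erase _ _ (Finset.mem_univ j), ← mul_assoc,
      jtDet_pieri (h j) (h0 j) (hneg j), Finset.sum_mul]
    · rw [List.count_eq_zero]
      intro hmem
      have := hw.row_lt hmem
      simp at this; omega
    · intro i
      simpa using hw.count_succ_le j i
  rw [Finset.mul_sum, Finset.sum_congr rfl hpieri, Finset.sum_sigma']
  symm
  refine Finset.sum_nbij (fun w => ⟨w.drop m, fun i : Fin (N + 1) => (w.take m).count (j, (i : ℕ))⟩)
    ?_ ?_ ?_ ?_
  · intro w hw
    simp only [Set.Finite.mem_toFinset, Set.mem_ofPred_eq] at hw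
    obtain ⟨hw, hs, hl, hL⟩ := hw
    have hlen : (w.take m).length = m := by simp; omega
    rw [← List.take_append_drop m w] at hw
    have hd := hw.of_append
    have hst := (isLatticeWord_append_iff hs hd).1 hw
    have hsum := wordComp_sum (w.drop m)
    rw [hL] at hsum
    rw [Finset.mem_sigma, mem_compWords, mem_strips _ _ fun i => by
      simpa using hd.count_succ_le j i]
    refine ⟨⟨hd, hL⟩, ?_, fun i => by simpa using hst i⟩
    conv_rhs => rw [← hlen]
    have hmem : ∀ x ∈ w.take m, x ∈ (Finset.univ : Finset (Fin (N + 1))).image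
        fun i : Fin (N + 1) => (j, (i : ℕ)) := by
      intro x hx
      have h1 := hw.row_lt (List.mem_append_left _ hx)
      rw [List.length_append, hlen] at h1
      simp only [Finset.mem_image, Finset.mem_univ, true_and]
      exact ⟨⟨x.2, by omega⟩, by rw [← hs.1 x hx]⟩
    have key : ∑ i : Fin (N + 1), (w.take m).count (j, (i : ℕ)) =
        ∑ x ∈ (w.take m).toFinset, (w.take m).count x := by
      rw [Finset.sum_subset (s₁ := (w.take m).toFinset)
        (s₂ := (Finset.univ : Finset (Fin (N + 1))).image fun i : Fin (N + 1) => (j, (i : ℕ)))]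
      · rw [Finset.sum_image]
        intro i _ i' _ hii
        simp at hii
        exact Fin.ext hii
      · intro x hx
        exact hmem x (List.mem_toFinset.1 hx)
      · intro x _ hx
        rw [List.mem_toFinset] at hx
        exact List.count_eq_zero.2 hx
    refine key.trans ?_
    rw [← List.sum_toFinset_count_eq_length]
    convert rfl
  · intro w hw w' hw' heq
    simp only [Set.Finite.coe_toFinset, Set.mem_ofPred_eq] at hw hw'
    simp only [Sigma.mk.injEq] at heq
    obtain ⟨h1, h2⟩ := heq
    have h2 := eq_of_heq h2
    rw [← List.take_append_drop m w, ← List.take_append_drop m w', h1]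
    congr 1
    refine hw.2.1.eq_of_count hw'.2.1 fun i => ?_
    by_cases hi : i < N + 1
    · exact congrFun h2 ⟨i, hi⟩
    · have aux : ∀ v : List (Fin r × ℕ), IsLatticeWord v → (v.drop m).length + m = v.length →
          wordComp (v.drop m) = L → (v.take m).count (j, i) = 0 := by
        intro v hv hl hL
        rw [List.count_eq_zero]
        intro hmem
        have h3 := hv.row_lt (List.mem_of_mem_take hmem)
        have hsum := wordComp_sum (v.drop m)
        rw [hL] at hsum
        simp at h3
        omega
      rw [aux w hw.1 hw.2.2.1 hw.2.2.2, aux w' hw'.1 hw'.2.2.1 hw'.2.2.2]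
  · rintro ⟨w, a⟩ hwa
    simp only [Finset.coe_sigma, Set.mem_sigma_iff, Finset.mem_coe] at hwa
    obtain ⟨hw, ha⟩ := hwa
    have hlen := length_of_mem_compWords hw
    obtain ⟨hw, hL⟩ := mem_compWords.1 hw
    rw [mem_strips _ _ fun i => by simpa using hw.count_succ_le j i] at ha
    obtain ⟨hsum, ha⟩ := ha
    obtain ⟨u, hu, hul, hc, hc'⟩ := exists_stripWord j a
    have hum : u.length = m := hul.trans hsum
    refine ⟨u ++ w, ?_, ?_⟩
    · simp only [Set.Finite.coe_toFinset, Set.mem_ofPred_eq]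
      rw [← hum, List.take_left, List.drop_left]
      refine ⟨(isLatticeWord_append_iff hu hw).2 fun i => ?_, hu, by simp; omega, hL⟩
      by_cases hi : i < N
      · have := ha ⟨i, hi⟩
        rw [← hc] at this
        simpa using this
      · rw [hc' _ (by omega), add_zero]
        exact hw.count_succ_le j i
    · subst hum
      simp [hc]
  · intro w hw
    simp only [Set.Finite.mem_toFinset, Set.mem_ofPred_eq] at hw
    rw [wordSchur, ← Finset.mul_prod_erase _ _ (Finset.mem_univ j)]
    congr 1
    · congr 1
      funext i
      conv_lhs => rw [← List.take_append_drop m w, List.count_append, add_comm]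
      rfl
    · refine Finset.prod_congr rfl fun j' hj' => ?_
      congr 1
      funext i
      conv_lhs => rw [← List.take_append_drop m w, List.count_append, add_comm]
      rw [List.count_eq_zero.2 (fun hmem => (Finset.mem_erase.1 hj').1 (hw.2.1.1 _ hmem)), add_zero]

theorem stripExtensions_iff {r : ℕ} {L : List (ℕ × Fin r)} (hL : ∀ p ∈ L, 0 < p.1) {m : ℕ}
    (hm : 0 < m) (j : Fin r) (w : List (Fin r × ℕ)) :
    (IsStripWord j (w.take m) ∧ (w.drop m).length + m = w.length ∧ wordComp (w.drop m) = L) ↔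
      wordComp w = (m, j) :: L ∨ ∃ q L', L = (q, j) :: L' ∧ wordComp w = (m + q, j) :: L' := by
  constructor
  · rintro ⟨h1, h2, h3⟩
    have hlen : (w.take m).length = m := by simp; omega
    have := wordComp_append (w := w.drop m) h1 (by intro h; simp [h] at hlen; omega)
    rwa [List.take_append_drop, hlen, h3] at this
  · obtain ⟨m, rfl⟩ := Nat.exists_eq_succ_of_ne_zero hm.ne'
    rintro (h | ⟨q, L', rfl, h⟩)
    · simpa using wordComp_take_drop m 0 L w h
    · have hq := hL _ (List.mem_cons_self ..)
      have := wordComp_take_drop m q L' w h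
      rwa [if_neg (by simp at hq; omega)] at this

/-- The sum of the products of Jacobi–Trudi determinants over all lattice words with reversed
colored descent composition `L`. -/
noncomputable def compSchur {R : Type*} [CommRing R] {r : ℕ} (h : Fin r → ℤ → R) (N : ℕ)
    (L : List (ℕ × Fin r)) : R :=
  ∑ w ∈ compWords L, wordSchur h N w

theorem compSchur_singleton {R : Type*} [CommRing R] {r : ℕ} (h : Fin r → ℤ → R)
    (h0 : ∀ j, h j 0 = 1) (hneg : ∀ j, ∀ k < 0, h j k = 0) {m : ℕ} (j : Fin r) {N : ℕ}
    (hm : 0 < m) (hN : m ≤ N) : compSchur h N [(m, j)] = h j m := by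
  obtain ⟨N, rfl⟩ := Nat.exists_eq_succ_of_ne_zero (show N ≠ 0 by omega)
  have h1 := mul_sum_compWords h h0 hneg [] m j hm (N := N) (by simpa using hN)
  have h2 : compWords ([] : List (ℕ × Fin r)) = {[]} := by
    ext w
    rw [mem_compWords, wordComp_eq_nil]
    simp only [Finset.mem_singleton, and_iff_right_iff_imp]
    rintro rfl
    trivial
  have h3 : wordSchur h (N + 1) [] = 1 := by
    refine Finset.prod_eq_one fun j _ => ?_
    rw [jtDet_stable (h j) (h0 j) (hneg j) (fun i => List.count (j, i) []) (Nat.zero_le _)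
      (fun _ _ => rfl)]
    simp [jtDet]
  rw [h2, Finset.sum_singleton, h3, mul_one] at h1
  rw [h1, compSchur]
  refine Finset.sum_congr ?_ fun _ _ => rfl
  ext w
  rw [mem_compWords, Set.Finite.mem_toFinset, Set.mem_ofPred_eq, stripExtensions_iff (by simp) hm]
  simp

theorem compSchur_cons_cons {R : Type*} [CommRing R] {r : ℕ} (h : Fin r → ℤ → R)
    (h0 : ∀ j, h j 0 = 1) (hneg : ∀ j, ∀ k < 0, h j k = 0) {m q : ℕ} (j i : Fin r)
    (L : List (ℕ × Fin r)) {N : ℕ} (hm : 0 < m) (hq : 0 < q) (hL : ∀ p ∈ L, 0 < p.1)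
    (hN : (L.map Prod.fst).sum + q + m ≤ N) :
    compSchur h N ((m, j) :: (q, i) :: L) = h j m * compSchur h N ((q, i) :: L) -
      if i = j then compSchur h N ((m + q, j) :: L) else 0 := by
  obtain ⟨N, rfl⟩ := Nat.exists_eq_succ_of_ne_zero (show N ≠ 0 by omega)
  have hL' : ∀ p ∈ (q, i) :: L, 0 < p.1 := by
    intro p hp
    rcases List.mem_cons.1 hp with rfl | hp
    · exact hq
    · exact hL p hp
  rw [eq_sub_iff_add_eq]
  rw [compSchur, compSchur.eq_def h N.succ ((q, i) :: L), Nat.succ_eq_add_one,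
    mul_sum_compWords h h0 hneg _ m j hm (N := N) (by simp; omega)]
  split_ifs with hij
  · subst hij
    rw [compSchur, ← Finset.sum_union]
    · refine Finset.sum_congr ?_ fun _ _ => rfl
      ext w
      rw [Finset.mem_union, mem_compWords, mem_compWords, Set.Finite.mem_toFinset,
        Set.mem_ofPred_eq, stripExtensions_iff hL' hm, ← and_or_left]
      refine and_congr_right fun _ => or_congr_right ?_
      constructor
      · intro h; exact ⟨q, L, rfl, h⟩
      · rintro ⟨q', L', h1, h2⟩
        simp at h1
        rw [h2, h1.1, h1.2]
    · rw [Finset.disjoint_left]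
      intro w hw hw'
      have h1 := (mem_compWords.1 hw).2
      rw [(mem_compWords.1 hw').2] at h1
      simp at h1
  · rw [add_zero]
    refine Finset.sum_congr ?_ fun _ _ => rfl
    ext w
    rw [mem_compWords, Set.Finite.mem_toFinset,
        Set.mem_ofPred_eq, stripExtensions_iff hL' hm]
    refine and_congr_right fun _ => ?_
    constructor
    · exact Or.inl
    · rintro (h | ⟨q', L', h1, h2⟩)
      · exact h
      · simp at h1
        exact absurd h1.1.2 hij

/-- The colored compositions obtained by merging consecutive parts of equal color. -/
def coarsenings {r : ℕ} : List (ℕ × Fin r) → Finset (List (ℕ × Fin r))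
  | [] => {[]}
  | [x] => {[x]}
  | x :: y :: l => (coarsenings (y :: l)).image (List.cons x) ∪
      if x.2 = y.2 then coarsenings ((x.1 + y.1, x.2) :: l) else ∅
termination_by l => l.length

theorem colorWord_cons {r : ℕ} (x : ℕ × Fin r) (l : List (ℕ × Fin r)) :
    colorWord (x :: l) = List.replicate x.1 x.2 ++ colorWord l := by
  simp [colorWord]

theorem length_colorWord {r : ℕ} (l : List (ℕ × Fin r)) :
    (colorWord l).length = (l.map Prod.fst).sum := by
  induction l with
  | nil => rfl
  | cons x l ih => simp [colorWord_cons, ih]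

theorem cInnerSums_nil {r : ℕ} : cInnerSums ([] : List (ℕ × Fin r)) = ∅ := by
  ext; simp [cInnerSums]

theorem cInnerSums_singleton {r : ℕ} (x : ℕ × Fin r) : cInnerSums [x] = ∅ := by
  ext; simp [cInnerSums]

theorem mem_cInnerSums_cons_cons {r : ℕ} {x y : ℕ × Fin r} {l : List (ℕ × Fin r)} {m : ℕ} :
    m ∈ cInnerSums (x :: y :: l) ↔ m = x.1 ∨ ∃ s ∈ cInnerSums (y :: l), m = x.1 + s := by
  constructor
  · rintro ⟨k, hk, rfl⟩
    cases k with
    | zero => simp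
    | succ k =>
      right
      exact ⟨_, ⟨k, by simpa using hk, rfl⟩, by simp⟩
  · rintro (rfl | ⟨s, ⟨k, hk, rfl⟩, rfl⟩)
    · exact ⟨0, by simp, by simp⟩
    · exact ⟨k + 1, by simpa using hk, by simp⟩

theorem le_of_mem_cInnerSums_cons {r : ℕ} {x : ℕ × Fin r} {l : List (ℕ × Fin r)} {m : ℕ}
    (hm : m ∈ cInnerSums (x :: l)) : x.1 ≤ m := by
  cases l with
  | nil => simp [cInnerSums_singleton] at hm
  | cons y l =>
    rcases mem_cInnerSums_cons_cons.1 hm with rfl | ⟨s, -, rfl⟩ <;> omega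

theorem mem_cInnerSums_merge {r : ℕ} {x y : ℕ × Fin r} {l : List (ℕ × Fin r)} {m : ℕ} (c : Fin r) :
    m ∈ cInnerSums ((x.1 + y.1, c) :: l) ↔ ∃ s ∈ cInnerSums (y :: l), m = x.1 + s := by
  cases l with
  | nil => simp [cInnerSums_singleton]
  | cons z l =>
    rw [mem_cInnerSums_cons_cons]
    simp only [mem_cInnerSums_cons_cons]
    constructor
    · rintro (rfl | ⟨s, hs, rfl⟩)
      · exact ⟨y.1, Or.inl rfl, rfl⟩
      · exact ⟨y.1 + s, Or.inr ⟨s, hs, rfl⟩, by omega⟩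
    · rintro ⟨s, rfl | ⟨s, hs, rfl⟩, rfl⟩
      · exact Or.inl rfl
      · exact Or.inr ⟨s, hs, by omega⟩

theorem sum_eq_of_coarserC {r : ℕ} {b l : List (ℕ × Fin r)} (h : coarserC b l) :
    (b.map Prod.fst).sum = (l.map Prod.fst).sum := by
  rw [← length_colorWord, ← length_colorWord, h.1]

theorem colorWord_merge {r : ℕ} (x y : ℕ × Fin r) (l : List (ℕ × Fin r)) (h : x.2 = y.2) :
    colorWord ((x.1 + y.1, x.2) :: l) = colorWord (x :: y :: l) := by
  simp only [colorWord_cons, List.replicate_add, h, List.append_assoc]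

theorem pos_merge {r : ℕ} {x y : ℕ × Fin r} {l : List (ℕ × Fin r)}
    (hl : ∀ p ∈ x :: y :: l, 0 < p.1) : ∀ p ∈ (x.1 + y.1, x.2) :: l, 0 < p.1 := by
  intro p hp
  rcases List.mem_cons.1 hp with rfl | hp
  · have := hl x (by simp)
    simp; omega
  · exact hl p (by simp [hp])

theorem coarserC_of_mem {r : ℕ} (l : List (ℕ × Fin r)) (hl : ∀ p ∈ l, 0 < p.1)
    (b : List (ℕ × Fin r)) (hb : b ∈ coarsenings l) : (∀ p ∈ b, 0 < p.1) ∧ coarserC b l := by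
  induction l using coarsenings.induct generalizing b with
  | case1 =>
    rw [coarsenings, Finset.mem_singleton] at hb
    subst hb
    exact ⟨by simp, rfl, subset_rfl⟩
  | case2 x =>
    rw [coarsenings, Finset.mem_singleton] at hb
    subst hb
    exact ⟨hl, rfl, subset_rfl⟩
  | case3 x y l ih1 ih2 =>
    rw [coarsenings, Finset.mem_union, Finset.mem_image] at hb
    rcases hb with ⟨b, hb, rfl⟩ | hb
    · obtain ⟨h1, h2⟩ := ih1 (fun p hp => hl p (List.mem_cons_of_mem _ hp)) b hb
      refine ⟨?_, ?_, ?_⟩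
      · intro p hp
        rcases List.mem_cons.1 hp with rfl | hp
        · exact hl _ (by simp)
        · exact h1 p hp
      · rw [colorWord_cons, h2.1, ← colorWord_cons]
      · intro m hm
        cases b with
        | nil => simp [cInnerSums_singleton] at hm
        | cons z b =>
          rw [mem_cInnerSums_cons_cons] at hm ⊢
          exact hm.imp id fun ⟨s, hs, h⟩ => ⟨s, h2.2 hs, h⟩
    · split_ifs at hb with hxy
      · obtain ⟨h1, h2⟩ := ih2 (pos_merge hl) b hb
        refine ⟨h1, ?_, ?_⟩
        · rw [h2.1, colorWord_merge _ _ _ hxy]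
        · intro m hm
          have := h2.2 hm
          rw [mem_cInnerSums_merge] at this
          exact mem_cInnerSums_cons_cons.2 (Or.inr this)
      · simp at hb

theorem mem_coarsenings_of_coarserC {r : ℕ} (l : List (ℕ × Fin r)) (hl : ∀ p ∈ l, 0 < p.1)
    (b : List (ℕ × Fin r)) (hb : ∀ p ∈ b, 0 < p.1) (hbl : coarserC b l) : b ∈ coarsenings l := by
  have hsum := sum_eq_of_coarserC hbl
  induction l using coarsenings.induct generalizing b with
  | case1 =>
    cases b with
    | nil => simp [coarsenings]
    | cons z b =>
      have := hb z (by simp)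
      simp at hsum; omega
  | case2 x =>
    cases b with
    | nil =>
      have := hl x (by simp)
      simp at hsum; omega
    | cons z b =>
      cases b with
      | nil =>
        simp at hsum
        have h := hbl.1
        have := hl x (by simp)
        obtain ⟨k, hk⟩ := Nat.exists_eq_succ_of_ne_zero this.ne'
        simp [colorWord, hsum, hk, List.replicate_succ] at h
        simp [coarsenings, Prod.ext_iff, hsum, h.1]
      | cons z' b =>
        have := hbl.2 (mem_cInnerSums_cons_cons.2 (Or.inl rfl))
        simp [cInnerSums_singleton] at this
  | case3 x y l ih1 ih2 =>
    have hx := hl x (by simp)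
    have hy := hl y (by simp)
    obtain ⟨kx, hkx⟩ := Nat.exists_eq_succ_of_ne_zero hx.ne'
    cases b with
    | nil => simp at hsum; omega
    | cons z b =>
      have hz := hb z (by simp)
      have hxz : x.1 ≤ z.1 := by
        cases b with
        | nil => simp at hsum; omega
        | cons z' b =>
          exact le_of_mem_cInnerSums_cons (hbl.2 (mem_cInnerSums_cons_cons.2 (Or.inl rfl)))
      have hcw := hbl.1
      rw [colorWord_cons, colorWord_cons] at hcw
      have hzx : z.2 = x.2 := by
        have := congrArg (fun L => L[0]?) hcw
        simpa [List.getElem?_append, List.getElem?_replicate, hx, hz] using this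
      rw [coarsenings, Finset.mem_union, Finset.mem_image]
      rcases hxz.eq_or_lt with h | h
      · left
        obtain rfl : x = z := Prod.ext h hzx.symm
        have hcw := List.append_cancel_left hcw
        refine ⟨b, ih1 (fun p hp => hl p (List.mem_cons_of_mem _ hp)) b
          (fun p hp => hb p (List.mem_cons_of_mem _ hp)) ⟨hcw, ?_⟩ (by simpa using hsum), rfl⟩
        intro s hs
        cases b with
        | nil => simp [cInnerSums_nil] at hs
        | cons z' b =>
          have h1 := hbl.2 (mem_cInnerSums_cons_cons.2 (Or.inr ⟨s, hs, rfl⟩))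
          have h2 := le_of_mem_cInnerSums_cons hs
          have h3 := hb z' (by simp)
          rcases mem_cInnerSums_cons_cons.1 h1 with h1 | ⟨s', hs', h1⟩
          · omega
          · rwa [show s = s' by omega]
      · right
        have hxy : x.2 = y.2 := by
          have := congrArg (fun L => L[x.1]?) hcw
          rw [colorWord_cons] at this
          simp [List.getElem?_append, h, hy] at this
          rw [← this, hzx]
        rw [if_pos hxy]
        refine ih2 (pos_merge hl) _ hb ⟨?_, ?_⟩ (by simpa [add_assoc] using hsum)
        · rw [hbl.1, colorWord_merge _ _ _ hxy]
        · intro s hs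
          rw [mem_cInnerSums_merge]
          have h2 := le_of_mem_cInnerSums_cons hs
          refine (mem_cInnerSums_cons_cons.1 (hbl.2 hs)).resolve_left (by omega)

theorem mem_coarsenings {r : ℕ} {l : List (ℕ × Fin r)} (hl : ∀ p ∈ l, 0 < p.1)
    {b : List (ℕ × Fin r)} :
    b ∈ coarsenings l ↔ (∀ p ∈ b, 0 < p.1) ∧ coarserC b l :=
  ⟨coarserC_of_mem l hl b, fun h => mem_coarsenings_of_coarserC l hl b h.1 h.2⟩

theorem length_le_of_mem_coarsenings {r : ℕ} {l b : List (ℕ × Fin r)} (hb : b ∈ coarsenings l) :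
    b.length ≤ l.length := by
  induction l using coarsenings.induct generalizing b with
  | case1 => simp_all [coarsenings]
  | case2 x => simp_all [coarsenings]
  | case3 x y l ih1 ih2 =>
    rw [coarsenings, Finset.mem_union, Finset.mem_image] at hb
    rcases hb with ⟨b, hb, rfl⟩ | hb
    · simpa using ih1 hb
    · split_ifs at hb with hxy
      · have := ih2 hb
        simp at this ⊢; omega
      · simp at hb

/-- The alternating sum of products over all coarsenings, computed recursively. -/
def ribbonProd {R : Type*} [CommRing R] {r : ℕ} (h : Fin r → ℤ → R) : List (ℕ × Fin r) → R
  | [] => 1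
  | [x] => h x.2 x.1
  | x :: y :: l => h x.2 x.1 * ribbonProd h (y :: l) -
      if x.2 = y.2 then ribbonProd h ((x.1 + y.1, x.2) :: l) else 0
termination_by l => l.length

theorem sum_coarsenings {R : Type*} [CommRing R] {r : ℕ} (h : Fin r → ℤ → R)
    (l : List (ℕ × Fin r)) (hl : ∀ p ∈ l, 0 < p.1) :
    ∑ b ∈ coarsenings l, (-1) ^ (l.length - b.length) * (b.map fun p => h p.2 p.1).prod =
      ribbonProd h l := by
  induction l using coarsenings.induct with
  | case1 => simp [coarsenings, ribbonProd]
  | case2 x => simp [coarsenings, ribbonProd]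
  | case3 x y l ih1 ih2 =>
    have hy := hl y (by simp)
    rw [coarsenings, ribbonProd, Finset.sum_union, Finset.sum_image (by simp), sub_eq_add_neg,
      ← ih1 fun p hp => hl p (List.mem_cons_of_mem _ hp), Finset.mul_sum]
    · congr 1
      · refine Finset.sum_congr rfl fun b _ => ?_
        simp [mul_left_comm]
      · split_ifs with hxy
        · rw [← ih2 (pos_merge hl), ← Finset.sum_neg_distrib]
          refine Finset.sum_congr rfl fun b hb => ?_
          have := length_le_of_mem_coarsenings hb
          simp only [List.length_cons] at this ⊢
          rw [Nat.succ_sub this, pow_succ]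
          ring
        · simp
    · rw [Finset.disjoint_left]
      intro b hb hb'
      obtain ⟨b, hb, rfl⟩ := Finset.mem_image.1 hb
      split_ifs at hb' with hxy
      · have h1 := (coarserC_of_mem _ (pos_merge hl) _ hb').2
        cases b with
        | nil =>
          have := sum_eq_of_coarserC h1
          simp at this; omega
        | cons z b =>
          have := le_of_mem_cInnerSums_cons (h1.2 (mem_cInnerSums_cons_cons.2 (Or.inl rfl)))
          simp at this; omega
      · simp at hb'

theorem ribbonProd_append {R : Type*} [CommRing R] {r : ℕ} (h : Fin r → ℤ → R)
    (l : List (ℕ × Fin r)) (q m : ℕ) (i j : Fin r) :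
    ribbonProd h (l ++ [(q, i), (m, j)]) = h j m * ribbonProd h (l ++ [(q, i)]) -
      if i = j then ribbonProd h (l ++ [(m + q, j)]) else 0 := by
  induction l using coarsenings.induct with
  | case1 =>
    simp only [List.nil_append, ribbonProd]
    by_cases hij : i = j
    · simp [hij, add_comm, mul_comm]
    · simp [hij, mul_comm]
  | case2 x =>
    simp only [List.cons_append, List.nil_append, ribbonProd]
    by_cases hij : i = j
    · subst hij
      by_cases hx : x.2 = i
      · subst hx
        simp [add_comm, add_left_comm]
        ring
      · simp [hx, add_comm]
        ring
    · by_cases hx : x.2 = i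
      · subst hx
        simp [hij]
        ring
      · simp [hx, hij]
        ring
  | case3 x y l ih1 ih2 =>
    simp only [List.cons_append, ribbonProd] at ih1 ih2 ⊢
    rw [ih1, ih2]
    split_ifs <;> ring

theorem compSchur_eq_ribbonProd {R : Type*} [CommRing R] {r : ℕ} (h : Fin r → ℤ → R)
    (h0 : ∀ j, h j 0 = 1) (hneg : ∀ j, ∀ k < 0, h j k = 0) {N : ℕ} (L : List (ℕ × Fin r))
    (hne : L ≠ []) (hL : ∀ p ∈ L, 0 < p.1) (hN : (L.map Prod.fst).sum ≤ N) :
    compSchur h N L = ribbonProd h L.reverse := by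
  induction L using coarsenings.induct with
  | case1 => exact absurd rfl hne
  | case2 x =>
    simp at hN
    rw [List.reverse_singleton, ribbonProd, ← compSchur_singleton h h0 hneg x.2 (hL x (by simp)) hN]
  | case3 x y l ih1 ih2 =>
    obtain ⟨m, j⟩ := x
    obtain ⟨q, i⟩ := y
    have hm := hL (m, j) (by simp)
    have hq := hL (q, i) (by simp)
    simp at hN hm hq
    rw [compSchur_cons_cons h h0 hneg j i l hm hq (fun p hp => hL p (by simp [hp])) (by omega),
      ih1 (by simp) (fun p hp => hL p (List.mem_cons_of_mem _ hp)) (by simp; omega),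
      ih2 (by simp) (pos_merge hL) (by simp; omega)]
    simp only [List.reverse_cons, List.append_assoc, List.cons_append, List.nil_append]
    rw [ribbonProd_append]

/-- The tableau recorded by a word: the box added by each letter contains its position. -/
def wordTab {r : ℕ} : List (Fin r × ℕ) → Fin r → ℤ × ℤ → ℕ
  | [] => fun _ _ => 0
  | x :: w => fun j c =>
      if j = x.1 ∧ c = ((x.2 : ℤ), (w.count x : ℤ)) then w.length + 1 else wordTab w j c

/-- The set of boxes added by a word. -/
def wordShape {r : ℕ} : List (Fin r × ℕ) → Fin r → Finset (ℤ × ℤ)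
  | [] => fun _ => ∅
  | x :: w => fun j =>
      if j = x.1 then insert ((x.2 : ℤ), (w.count x : ℤ)) (wordShape w j) else wordShape w j

theorem wordTab_cons {r : ℕ} (x : Fin r × ℕ) (w : List (Fin r × ℕ)) (j : Fin r) (c : ℤ × ℤ) :
    wordTab (x :: w) j c =
      if j = x.1 ∧ c = ((x.2 : ℤ), (w.count x : ℤ)) then w.length + 1 else wordTab w j c :=
  rfl

theorem wordShape_cons {r : ℕ} (x : Fin r × ℕ) (w : List (Fin r × ℕ)) (j : Fin r) :
    wordShape (x :: w) j =
      if j = x.1 then insert ((x.2 : ℤ), (w.count x : ℤ)) (wordShape w j) else wordShape w j :=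
  rfl

theorem mem_wordShape_cons {r : ℕ} {x : Fin r × ℕ} {w : List (Fin r × ℕ)} {j : Fin r} {c : ℤ × ℤ} :
    c ∈ wordShape (x :: w) j ↔
      (j = x.1 ∧ c = ((x.2 : ℤ), (w.count x : ℤ))) ∨ c ∈ wordShape w j := by
  rw [wordShape_cons]
  split_ifs with h <;> simp [h]

theorem mem_wordShape {r : ℕ} {w : List (Fin r × ℕ)} {j : Fin r} {c : ℤ × ℤ} :
    c ∈ wordShape w j ↔ 0 ≤ c.1 ∧ 0 ≤ c.2 ∧ c.2 < w.count (j, c.1.toNat) := by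
  induction w with
  | nil => simp [wordShape]
  | cons x w ih =>
    obtain ⟨j', i⟩ := x
    obtain ⟨a, b⟩ := c
    rw [mem_wordShape_cons, ih, List.count_cons]
    simp only [beq_iff_eq, Prod.mk.injEq]
    constructor
    · rintro (⟨rfl, rfl, rfl⟩ | ⟨h1, h2, h3⟩)
      · simp
      · refine ⟨h1, h2, ?_⟩
        push_cast
        split_ifs <;> omega
    · rintro ⟨h1, h2, h3⟩
      split_ifs at h3 with h
      · obtain ⟨rfl, rfl⟩ := h
        by_cases hb : b = (w.count (j', a.toNat) : ℤ)
        · left; exact ⟨rfl, by omega, hb⟩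
        · right; refine ⟨h1, h2, ?_⟩; push_cast at h3; omega
      · right; exact ⟨h1, h2, by simpa using h3⟩

theorem newCell_notMem {r : ℕ} (x : Fin r × ℕ) (w : List (Fin r × ℕ)) :
    ((x.2 : ℤ), (w.count x : ℤ)) ∉ wordShape w x.1 := by
  simp [mem_wordShape]

theorem wordTab_le {r : ℕ} (w : List (Fin r × ℕ)) (j : Fin r) (c : ℤ × ℤ) :
    wordTab w j c ≤ w.length := by
  induction w with
  | nil => simp [wordTab]
  | cons x w ih =>
    rw [wordTab_cons]
    split_ifs
    · simp
    · simp; omega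

theorem wordTab_pos_iff {r : ℕ} {w : List (Fin r × ℕ)} {j : Fin r} {c : ℤ × ℤ} :
    0 < wordTab w j c ↔ c ∈ wordShape w j := by
  induction w with
  | nil => simp [wordTab, wordShape]
  | cons x w ih =>
    rw [wordTab_cons, mem_wordShape_cons, ← ih]
    split_ifs with h <;> simp [h]

theorem wordTab_newCell {r : ℕ} (x : Fin r × ℕ) (w : List (Fin r × ℕ)) :
    wordTab w x.1 ((x.2 : ℤ), (w.count x : ℤ)) = 0 := by
  have := mt wordTab_pos_iff.1 (newCell_notMem x w)
  omega

theorem wordTab_cons_eq_iff_of_le {r : ℕ} {x : Fin r × ℕ} {w : List (Fin r × ℕ)} {j : Fin r}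
    {c : ℤ × ℤ} {m : ℕ} (h1 : 1 ≤ m) (h2 : m ≤ w.length) :
    wordTab (x :: w) j c = m ↔ wordTab w j c = m := by
  rw [wordTab_cons]
  split_ifs with h
  · obtain ⟨rfl, rfl⟩ := h
    rw [wordTab_newCell]
    omega
  · rfl

theorem wordTab_cons_eq_length_iff {r : ℕ} {x : Fin r × ℕ} {w : List (Fin r × ℕ)} {j : Fin r}
    {c : ℤ × ℤ} :
    wordTab (x :: w) j c = w.length + 1 ↔ j = x.1 ∧ c = ((x.2 : ℤ), (w.count x : ℤ)) := by
  rw [wordTab_cons]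
  have := wordTab_le w j c
  split_ifs with h
  · simp [h]
  · simp only [h, iff_false]; omega

theorem isPartiteSYT_wordTab {r : ℕ} {w : List (Fin r × ℕ)} (hw : IsLatticeWord w) :
    IsPartiteSYT (wordShape w) w.length (wordTab w) := by
  refine ⟨?_, ?_, ?_, ?_, ?_⟩
  · intro j c hc
    have := mt wordTab_pos_iff.1 hc
    omega
  · intro j c hc
    rw [Finset.mem_Icc]
    exact ⟨wordTab_pos_iff.2 hc, wordTab_le w j c⟩
  · induction w with
    | nil => simp
    | cons x w ih =>
      intro m hm
      rw [Finset.mem_Icc] at hm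
      rcases hm.2.eq_or_lt with rfl | hlt
      · refine ⟨(x.1, ((x.2 : ℤ), (w.count x : ℤ))), ⟨?_, ?_⟩, ?_⟩
        · exact mem_wordShape_cons.2 (Or.inl ⟨rfl, rfl⟩)
        · exact wordTab_cons_eq_length_iff.2 ⟨rfl, rfl⟩
        · rintro ⟨j, c⟩ ⟨-, h⟩
          obtain ⟨h1, h2⟩ := wordTab_cons_eq_length_iff.1 h
          exact Prod.ext h1 h2
      · have hlt : m ≤ w.length := by simp at hlt; omega
        obtain ⟨p, ⟨hp1, hp2⟩, hp3⟩ := ih hw.1 m (Finset.mem_Icc.2 ⟨hm.1, hlt⟩)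
        refine ⟨p, ⟨mem_wordShape_cons.2 (Or.inr hp1), (wordTab_cons_eq_iff_of_le hm.1 hlt).2 hp2⟩, ?_⟩
        rintro q ⟨-, hq⟩
        have hq := (wordTab_cons_eq_iff_of_le hm.1 hlt).1 hq
        exact hp3 q ⟨wordTab_pos_iff.1 (by omega), hq⟩
  · induction w with
    | nil => simp [wordShape]
    | cons x w ih =>
      intro j c hc hc'
      have hle := wordTab_le w j c
      by_cases h' : j = x.1 ∧ (c.1, c.2 + 1) = ((x.2 : ℤ), (w.count x : ℤ))
      · have h : ¬ (j = x.1 ∧ c = ((x.2 : ℤ), (w.count x : ℤ))) := by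
          rintro ⟨-, h⟩
          have := h'.2
          rw [h] at this
          simp at this
        rw [wordTab_cons, wordTab_cons, if_neg h, if_pos h']
        omega
      · have hm' := (mem_wordShape_cons.1 hc').resolve_left h'
        have hm : c ∈ wordShape w j := by
          rw [mem_wordShape] at hm' ⊢
          rw [mem_wordShape] at hc
          exact ⟨hc.1, hc.2.1, by have := hm'.2.2; simp at this; omega⟩
        have h : ¬ (j = x.1 ∧ c = ((x.2 : ℤ), (w.count x : ℤ))) := by
          rintro ⟨rfl, rfl⟩
          exact newCell_notMem x w hm
        rw [wordTab_cons, wordTab_cons, if_neg h, if_neg h']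
        exact ih hw.1 j c hm hm'
  · induction w with
    | nil => simp [wordShape]
    | cons x w ih =>
      intro j c hc hc'
      have hle := wordTab_le w j c
      by_cases h' : j = x.1 ∧ (c.1 + 1, c.2) = ((x.2 : ℤ), (w.count x : ℤ))
      · have h : ¬ (j = x.1 ∧ c = ((x.2 : ℤ), (w.count x : ℤ))) := by
          rintro ⟨-, h⟩
          have := h'.2
          rw [h] at this
          simp at this
        rw [wordTab_cons, wordTab_cons, if_neg h, if_pos h']
        omega
      · have hm' := (mem_wordShape_cons.1 hc').resolve_left h'
        have hm : c ∈ wordShape w j := by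
          rw [mem_wordShape] at hm' ⊢
          rw [mem_wordShape] at hc
          refine ⟨hc.1, hc.2.1, ?_⟩
          have h1 := hm'.2.2
          have h2 := hw.1.count_succ_le j c.1.toNat
          rw [show (c.1 + 1, c.2).1.toNat = c.1.toNat + 1 by have := hc.1; simp; omega] at h1
          simp at h1
          omega
        have h : ¬ (j = x.1 ∧ c = ((x.2 : ℤ), (w.count x : ℤ))) := by
          rintro ⟨rfl, rfl⟩
          exact newCell_notMem x w hm
        rw [wordTab_cons, wordTab_cons, if_neg h, if_neg h']
        exact ih hw.1 j c hm hm'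

theorem wordTab_injective {r : ℕ} {w w' : List (Fin r × ℕ)} (hl : w.length = w'.length)
    (h : wordTab w = wordTab w') : w = w' := by
  induction w generalizing w' with
  | nil => exact (List.eq_nil_of_length_eq_zero hl.symm).symm
  | cons x w ih =>
    cases w' with
    | nil => simp at hl
    | cons x' w' =>
      have hl' : w.length = w'.length := by simpa using hl
      have h1 := (wordTab_cons_eq_length_iff (x := x) (w := w)).2 ⟨rfl, rfl⟩
      rw [h, hl'] at h1
      obtain ⟨h2, h3⟩ := wordTab_cons_eq_length_iff.1 h1
      have hx : x = x' := Prod.ext h2 (by simpa using (Prod.ext_iff.1 h3).1)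
      subst hx
      rw [ih hl']
      funext j c
      by_cases hc : j = x.1 ∧ c = ((x.2 : ℤ), (w.count x : ℤ))
      · obtain ⟨rfl, rfl⟩ := hc
        rw [wordTab_newCell, h3, wordTab_newCell]
      · have := congrFun (congrFun h j) c
        rwa [wordTab_cons, wordTab_cons, if_neg hc, if_neg (by rwa [← h3])] at this

/-- A tuple of cell sets is Young if every part is a Young diagram at the origin. -/
def IsYoungShape {r : ℕ} (sh : Fin r → Finset (ℤ × ℤ)) : Prop :=
  ∀ j, ∀ c ∈ sh j, 0 ≤ c.1 ∧ 0 ≤ c.2 ∧ (0 < c.1 → (c.1 - 1, c.2) ∈ sh j) ∧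
    (0 < c.2 → (c.1, c.2 - 1) ∈ sh j)

theorem exists_wordTab {r : ℕ} (n : ℕ) (sh : Fin r → Finset (ℤ × ℤ)) (T : Fin r → ℤ × ℤ → ℕ)
    (hsh : IsYoungShape sh) (hT : IsPartiteSYT sh n T) :
    ∃ w, IsLatticeWord w ∧ w.length = n ∧ wordShape w = sh ∧ wordTab w = T := by
  induction n generalizing sh T with
  | zero =>
    obtain ⟨h1, h2, -⟩ := hT
    have hempty : ∀ j c, c ∉ sh j := by
      intro j c hc
      have := h2 j c hc
      simp at this
    refine ⟨[], trivial, rfl, ?_, ?_⟩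
    · funext j
      exact (Finset.eq_empty_of_forall_notMem (hempty j)).symm
    · funext j c
      exact (h1 j c (hempty j c)).symm
  | succ n ih =>
    obtain ⟨h1, h2, h3, h4, h5⟩ := hT
    obtain ⟨⟨j₀, c₀⟩, ⟨hc₀, hT₀⟩, huniq⟩ := h3 (n + 1) (by simp)
    simp only at hc₀ hT₀
    have hle : ∀ j, ∀ c ∈ sh j, T j c ≤ n + 1 := fun j c hc => (Finset.mem_Icc.1 (h2 j c hc)).2
    have hright : (c₀.1, c₀.2 + 1) ∉ sh j₀ := by
      intro hc
      have := h4 j₀ c₀ hc₀ hc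
      have := hle _ _ hc
      omega
    have hdown : (c₀.1 + 1, c₀.2) ∉ sh j₀ := by
      intro hc
      have := h5 j₀ c₀ hc₀ hc
      have := hle _ _ hc
      omega
    set sh' : Fin r → Finset (ℤ × ℤ) := fun j => if j = j₀ then (sh j).erase c₀ else sh j with hsh'
    set T' : Fin r → ℤ × ℤ → ℕ := fun j c => if j = j₀ ∧ c = c₀ then 0 else T j c with hT'
    have hmem : ∀ j c, c ∈ sh' j ↔ c ∈ sh j ∧ ¬ (j = j₀ ∧ c = c₀) := by
      intro j c
      simp only [hsh']
      split_ifs with h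
      · simp [h, and_comm]
      · simp [h]
    have hTT' : ∀ j c, c ∈ sh' j → T' j c = T j c := by
      intro j c hc
      simp only [hT', if_neg ((hmem j c).1 hc).2]
    have hyoung : IsYoungShape sh' := by
      intro j c hc
      obtain ⟨hcs, hne⟩ := (hmem j c).1 hc
      obtain ⟨a1, a2, a3, a4⟩ := hsh j c hcs
      refine ⟨a1, a2, fun h => ?_, fun h => ?_⟩
      · refine (hmem _ _).2 ⟨a3 h, ?_⟩
        rintro ⟨rfl, rfl⟩
        exact hdown (by simpa using hcs)
      · refine (hmem _ _).2 ⟨a4 h, ?_⟩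
        rintro ⟨rfl, rfl⟩
        exact hright (by simpa using hcs)
    have hSYT : IsPartiteSYT sh' n T' := by
      refine ⟨?_, ?_, ?_, ?_, ?_⟩
      · intro j c hc
        simp only [hT']
        split_ifs with h
        · rfl
        · exact h1 j c fun hcs => hc ((hmem j c).2 ⟨hcs, h⟩)
      · intro j c hc
        rw [hTT' j c hc]
        obtain ⟨hc, hne⟩ := (hmem j c).1 hc
        have := Finset.mem_Icc.1 (h2 j c hc)
        have : T j c ≠ n + 1 := by
          intro h
          have := huniq (j, c) ⟨hc, h⟩
          exact hne (by simpa using this)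
        rw [Finset.mem_Icc]; omega
      · intro m hm
        rw [Finset.mem_Icc] at hm
        obtain ⟨p, ⟨hp1, hp2⟩, hp3⟩ := h3 m (Finset.mem_Icc.2 ⟨hm.1, by omega⟩)
        have hp : p.2 ∈ sh' p.1 := by
          refine (hmem _ _).2 ⟨hp1, ?_⟩
          rintro ⟨ha, hb⟩
          rw [ha, hb] at hp2
          omega
        refine ⟨p, ⟨hp, (hTT' _ _ hp).trans hp2⟩, ?_⟩
        rintro q ⟨hq1, hq2⟩
        rw [hTT' _ _ hq1] at hq2
        exact hp3 q ⟨((hmem _ _).1 hq1).1, hq2⟩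
      · intro j c hc hc'
        rw [hTT' _ _ hc, hTT' _ _ hc']
        exact h4 j c ((hmem _ _).1 hc).1 ((hmem _ _).1 hc').1
      · intro j c hc hc'
        rw [hTT' _ _ hc, hTT' _ _ hc']
        exact h5 j c ((hmem _ _).1 hc).1 ((hmem _ _).1 hc').1
    obtain ⟨w, hw, hlen, hwsh, hwT⟩ := ih sh' T' hyoung hSYT
    obtain ⟨b1, b2, b3, b4⟩ := hsh j₀ c₀ hc₀
    have hnot : c₀ ∉ wordShape w j₀ := by rw [hwsh, hmem]; simp
    have hcount : c₀.2 = w.count (j₀, c₀.1.toNat) := by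
      rw [mem_wordShape] at hnot
      by_cases h : 0 < c₀.2
      · have : (c₀.1, c₀.2 - 1) ∈ wordShape w j₀ := by
          rw [hwsh, hmem]
          refine ⟨b4 h, ?_⟩
          rintro ⟨-, h⟩
          have := congrArg Prod.snd h
          simp at this
        rw [mem_wordShape] at this
        simp only [b1, b2, true_and, not_lt] at hnot this
        omega
      · simp only [b1, b2, true_and, not_lt] at hnot
        omega
    have hcell : c₀ = ((c₀.1.toNat : ℤ), (w.count (j₀, c₀.1.toNat) : ℤ)) :=
      Prod.ext (by simp [b1]) hcount
    refine ⟨(j₀, c₀.1.toNat) :: w, ⟨hw, ?_⟩, by simp [hlen], ?_, ?_⟩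
    · by_cases h : 0 < c₀.1
      · right
        have : (c₀.1 - 1, c₀.2) ∈ wordShape w j₀ := by
          rw [hwsh, hmem]
          refine ⟨b3 h, ?_⟩
          rintro ⟨-, h⟩
          have := congrArg Prod.fst h
          simp at this
        have := (mem_wordShape.1 this).2.2
        rw [show (c₀.1 - 1, c₀.2).1.toNat = c₀.1.toNat - 1 by simp] at this
        simp only at this ⊢
        omega
      · left
        simp; omega
    · funext j
      ext c
      rw [mem_wordShape_cons, hwsh, hmem, ← hcell]
      by_cases h : j = j₀ ∧ c = c₀
      · simp only [h, true_and, true_or, true_iff]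
        exact hc₀
      · simp [h]
    · funext j c
      rw [wordTab_cons, ← hcell, hwT, hlen]
      simp only [hT']
      split_ifs with h
      · rw [h.1, h.2, hT₀]
      · rfl

theorem sum_card_wordShape {r : ℕ} (w : List (Fin r × ℕ)) :
    ∑ j, (wordShape w j).card = w.length := by
  induction w with
  | nil => simp [wordShape]
  | cons x w ih =>
    have : ∀ j, (wordShape (x :: w) j).card = (wordShape w j).card + if j = x.1 then 1 else 0 := by
      intro j
      rw [wordShape_cons]
      split_ifs with h
      · subst h
        exact Finset.card_insert_of_notMem (newCell_notMem x w)
      · rfl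
    rw [Finset.sum_congr rfl fun j _ => this j, Finset.sum_add_distrib, ih]
    simp

/-- The partial sums, from the end, of the sizes of a colored composition. -/
def partSums {r : ℕ} : List (ℕ × Fin r) → List ℕ
  | [] => []
  | p :: L => (p.1 + (L.map Prod.fst).sum) :: partSums L

@[simp]
theorem length_partSums {r : ℕ} (L : List (ℕ × Fin r)) : (partSums L).length = L.length := by
  induction L with
  | nil => rfl
  | cons p L ih => simp [partSums, ih]

theorem le_of_mem_partSums {r : ℕ} {L : List (ℕ × Fin r)} {m : ℕ} (hm : m ∈ partSums L) :
    m ≤ (L.map Prod.fst).sum := by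
  induction L with
  | nil => simp [partSums] at hm
  | cons p L ih =>
    rw [partSums, List.mem_cons] at hm
    simp only [List.map_cons, List.sum_cons]
    rcases hm with rfl | hm
    · rfl
    · have := ih hm
      omega

theorem one_le_of_mem_partSums {r : ℕ} {L : List (ℕ × Fin r)} (hL : ∀ p ∈ L, 0 < p.1) {m : ℕ}
    (hm : m ∈ partSums L) : 1 ≤ m := by
  induction L with
  | nil => simp [partSums] at hm
  | cons p L ih =>
    rw [partSums, List.mem_cons] at hm
    rcases hm with rfl | hm
    · have := hL p (by simp)
      omega
    · exact ih (fun q hq => hL q (List.mem_cons_of_mem _ hq)) hm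

theorem pairwise_partSums {r : ℕ} {L : List (ℕ × Fin r)} (hL : ∀ p ∈ L, 0 < p.1) :
    (partSums L).Pairwise (· > ·) := by
  induction L with
  | nil => simp [partSums]
  | cons p L ih =>
    rw [partSums, List.pairwise_cons]
    refine ⟨fun m hm => ?_, ih fun q hq => hL q (List.mem_cons_of_mem _ hq)⟩
    have := le_of_mem_partSums hm
    have := hL p (by simp)
    omega

theorem getD_reverse_partSums {r : ℕ} (L : List (ℕ × Fin r)) :
    (if L.length = 0 then 0 else (partSums L).reverse.getD (L.length - 1) 0) =
      (L.map Prod.fst).sum := by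
  cases L with
  | nil => rfl
  | cons p L => simp [partSums]

theorem map_range_partSums {r : ℕ} (f : ℕ → Fin r) (L : List (ℕ × Fin r))
    (hf : (partSums L).map f = L.map Prod.snd) :
    ((List.range (partSums L).reverse.length).map fun k =>
      ((partSums L).reverse.getD k 0 - (if k = 0 then 0 else (partSums L).reverse.getD (k - 1) 0),
        f ((partSums L).reverse.getD k 0))) = L.reverse := by
  induction L with
  | nil => rfl
  | cons p L ih =>
    simp only [partSums, List.map_cons, List.cons.injEq] at hf
    rw [List.reverse_cons, ← ih hf.2]
    simp only [List.length_reverse, length_partSums, List.length_cons, List.range_succ,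
      List.map_append, List.map_cons, List.map_nil]
    congr 1
    · refine List.map_congr_left fun k hk => ?_
      rw [List.mem_range] at hk
      have h1 : ∀ k < L.length, (partSums (p :: L)).reverse.getD k 0 =
          (partSums L).reverse.getD k 0 := by
        intro k hk
        rw [partSums, List.reverse_cons, List.getD_append _ _ _ _ (by simpa using hk)]
      rw [h1 k hk, h1 (k - 1) (by omega)]
    · have h1 : (partSums (p :: L)).reverse.getD L.length 0 = p.1 + (L.map Prod.fst).sum := by
        rw [partSums, List.reverse_cons, List.getD_append_right _ _ _ _ (by simp)]
        simp
      have h2 : (if L.length = 0 then 0 else (partSums (p :: L)).reverse.getD (L.length - 1) 0) =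
          (L.map Prod.fst).sum := by
        rw [← getD_reverse_partSums L]
        split_ifs with h
        · rfl
        · rw [partSums, List.reverse_cons, List.getD_append _ _ _ _ (by simp; omega)]
      rw [h2, h1, hf.1]
      simp

theorem mem_sDesPlusTab_wordTab {r : ℕ} {w : List (Fin r × ℕ)} {i : ℕ} :
    i ∈ sDesPlusTab (wordShape w) w.length (wordTab w) ↔ (1 ≤ i ∧ i ≤ w.length) ∧
      (i = w.length ∨ ∃ j c j' c', wordTab w j c = i ∧ wordTab w j' c' = i + 1 ∧
        (j ≠ j' ∨ c.1 < c'.1)) := by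
  rw [sDesPlusTab, Finset.mem_filter, Finset.mem_Icc]
  refine and_congr_right fun hi => or_congr_right ⟨?_, ?_⟩
  · rintro ⟨j, c, -, j', c', -, h⟩
    exact ⟨j, c, j', c', h⟩
  · rintro ⟨j, c, j', c', h⟩
    exact ⟨j, c, wordTab_pos_iff.1 (by omega), j', c', wordTab_pos_iff.1 (by omega), h⟩

theorem mem_sDesPlusTab_cons {r : ℕ} {x y : Fin r × ℕ} {w : List (Fin r × ℕ)} {i : ℕ} :
    i ∈ sDesPlusTab (wordShape (x :: y :: w)) (x :: y :: w).length (wordTab (x :: y :: w)) ↔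
      i = w.length + 2 ∨
        (i ∈ sDesPlusTab (wordShape (y :: w)) (y :: w).length (wordTab (y :: w)) ∧
          (i = w.length + 1 → IsWordDesc y x)) := by
  rw [mem_sDesPlusTab_wordTab, mem_sDesPlusTab_wordTab]
  simp only [List.length_cons]
  rcases lt_trichotomy i (w.length + 1) with h | rfl | h
  · have h1 : i ≠ w.length + 1 + 1 := by omega
    have h2 : i ≠ w.length + 2 := by omega
    have h3 : i ≠ w.length + 1 := by omega
    by_cases h4 : 1 ≤ i
    · have key : ∀ j c m, 1 ≤ m → m ≤ w.length + 1 →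
          (wordTab (x :: y :: w) j c = m ↔ wordTab (y :: w) j c = m) :=
        fun j c m hm hm' => wordTab_cons_eq_iff_of_le hm (by simpa using hm')
      simp only [h1, h3, h4, false_or, true_and, false_imp_iff, and_true]
      simp only [key _ _ i h4 (by omega), key _ _ (i + 1) (by omega) (by omega)]
      rw [and_congr_left_iff]
      intro; omega
    · simp [h4, h2]
  · have k1 : ∀ j c, wordTab (x :: y :: w) j c = w.length + 1 ↔
        j = y.1 ∧ c = ((y.2 : ℤ), (w.count y : ℤ)) := fun j c => by
      rw [wordTab_cons_eq_iff_of_le (by omega) (by simp), wordTab_cons_eq_length_iff]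
    have k2 : ∀ j c, wordTab (x :: y :: w) j c = w.length + 1 + 1 ↔
        j = x.1 ∧ c = ((x.2 : ℤ), ((y :: w).count x : ℤ)) := fun j c =>
      wordTab_cons_eq_length_iff (w := y :: w)
    simp only [k1, k2]
    constructor
    · rintro ⟨-, h | ⟨j, c, j', c', ⟨rfl, rfl⟩, ⟨rfl, rfl⟩, h⟩⟩
      · omega
      · right
        refine ⟨⟨⟨by omega, by omega⟩, by simp⟩, fun _ => ?_⟩
        simpa [IsWordDesc, eq_comm] using h
    · rintro (h | ⟨-, h⟩)
      · omega
      · refine ⟨⟨by omega, by omega⟩, Or.inr ⟨_, _, _, _, ⟨rfl, rfl⟩, ⟨rfl, rfl⟩, ?_⟩⟩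
        simpa [IsWordDesc, eq_comm] using h
  · constructor
    · rintro ⟨⟨h1, h2⟩, -⟩
      left; omega
    · rintro (rfl | ⟨⟨⟨h1, h2⟩, -⟩, -⟩)
      · exact ⟨⟨by omega, by omega⟩, Or.inl rfl⟩
      · omega

theorem sDesPlusTab_wordTab {r : ℕ} (w : List (Fin r × ℕ)) :
    sDesPlusTab (wordShape w) w.length (wordTab w) = (partSums (wordComp w)).toFinset := by
  ext i
  rw [List.mem_toFinset]
  induction w generalizing i with
  | nil => rw [mem_sDesPlusTab_wordTab]; simp [wordComp, partSums]; omega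
  | cons x w ih =>
    cases w with
    | nil =>
      rw [mem_sDesPlusTab_wordTab]
      simp [wordComp, partSums]
      omega
    | cons y w =>
      rw [mem_sDesPlusTab_cons, ih]
      obtain ⟨m, L, hL⟩ := exists_wordComp_cons y w
      have hsum := wordComp_sum (y :: w)
      have hpos := pairwise_partSums (wordComp_pos (y :: w))
      simp only [hL, List.map_cons, List.sum_cons, partSums, List.length_cons,
        List.pairwise_cons] at hsum hpos
      rw [wordComp, hL]
      split_ifs with h
      · simp only [h, partSums, List.mem_cons, List.map_cons, List.sum_cons, hsum]
        rw [show 1 + (w.length + 1) = w.length + 2 by omega]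
        simp
      · simp only [h, partSums, List.mem_cons, bumpHead, hsum, imp_false]
        rw [show 1 + m + (L.map Prod.fst).sum = w.length + 2 by omega]
        refine or_congr_right ⟨?_, fun hi => ⟨Or.inr hi, ?_⟩⟩
        · rintro ⟨h1 | h1, h2⟩
          · exact absurd h1 h2
          · exact h1
        · have := hpos.1 i hi
          omega

theorem tabColor_eq {r : ℕ} [NeZero r] (w : List (Fin r × ℕ)) {m : ℕ} (hm : 1 ≤ m) {j : Fin r}
    (h : ∃ c, wordTab w j c = m) (h' : ∀ j' c, wordTab w j' c = m → j' = j) :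
    tabColor (wordShape w) (wordTab w) m = j := by
  obtain ⟨c, hc⟩ := h
  have hex : ∃ p : Fin r × (ℤ × ℤ), p.2 ∈ wordShape w p.1 ∧ wordTab w p.1 p.2 = m :=
    ⟨(j, c), wordTab_pos_iff.1 (hc ▸ hm), hc⟩
  rw [tabColor, dif_pos hex]
  exact h' _ _ (Classical.choose_spec hex).2

theorem tabColor_cons {r : ℕ} [NeZero r] (x : Fin r × ℕ) (w : List (Fin r × ℕ)) {m : ℕ}
    (hm : 1 ≤ m) (hm' : m ≤ w.length) :
    tabColor (wordShape (x :: w)) (wordTab (x :: w)) m = tabColor (wordShape w) (wordTab w) m := by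
  have key : ∀ v : List (Fin r × ℕ), (fun p : Fin r × (ℤ × ℤ) =>
      p.2 ∈ wordShape v p.1 ∧ wordTab v p.1 p.2 = m) = fun p => wordTab v p.1 p.2 = m := by
    intro v
    funext p
    refine propext (and_iff_right_of_imp fun h => wordTab_pos_iff.1 (h ▸ hm))
  have key' : (fun p : Fin r × (ℤ × ℤ) => wordTab (x :: w) p.1 p.2 = m) =
      fun p => wordTab w p.1 p.2 = m := by
    funext p
    exact propext (wordTab_cons_eq_iff_of_le hm hm')
  have gen : ∀ P Q : Fin r × (ℤ × ℤ) → Prop, P = Q →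
      ∀ (d : Decidable (∃ p, P p)) (d' : Decidable (∃ p, Q p)),
      (if h : ∃ p, P p then (Classical.choose h).1 else 0) =
        (if h : ∃ p, Q p then (Classical.choose h).1 else 0) := by
    rintro P _ rfl d d'
    congr
  exact gen _ _ ((key _).trans (key'.trans (key _).symm)) _ _

theorem map_tabColor_partSums {r : ℕ} [NeZero r] (w : List (Fin r × ℕ)) :
    (partSums (wordComp w)).map (tabColor (wordShape w) (wordTab w)) =
      (wordComp w).map Prod.snd := by
  have top : ∀ x (w : List (Fin r × ℕ)),
      tabColor (wordShape (x :: w)) (wordTab (x :: w)) (w.length + 1) = x.1 := by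
    intro x w
    refine tabColor_eq _ (by omega) ⟨_, wordTab_cons_eq_length_iff.2 ⟨rfl, rfl⟩⟩ ?_
    intro j c h
    exact (wordTab_cons_eq_length_iff.1 h).1
  induction w with
  | nil => rfl
  | cons x w ih =>
    cases w with
    | nil => simpa [wordComp, partSums] using top x []
    | cons y w =>
      obtain ⟨m, L, hL⟩ := exists_wordComp_cons y w
      have hsum := wordComp_sum (y :: w)
      have hrec : (partSums (wordComp (y :: w))).map
          (tabColor (wordShape (x :: y :: w)) (wordTab (x :: y :: w))) =
          (wordComp (y :: w)).map Prod.snd := by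
        rw [← ih]
        refine List.map_congr_left fun i hi => tabColor_cons _ _ ?_ ?_
        · exact one_le_of_mem_partSums (wordComp_pos _) hi
        · exact (le_of_mem_partSums hi).trans hsum.le
      have htop := top x (y :: w)
      rw [hL] at hrec
      simp only [hL, List.map_cons, List.sum_cons, partSums, List.length_cons,
        List.cons.injEq] at hsum hrec htop
      rw [wordComp, hL]
      split_ifs with h
      · simp only [partSums, List.map_cons, List.sum_cons, hrec]
        rw [hsum, show 1 + (w.length + 1) = w.length + 1 + 1 by omega, htop]
      · simp only [partSums, List.map_cons, bumpHead, hrec]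
        rw [show 1 + m + (L.map Prod.fst).sum = w.length + 1 + 1 by omega, htop]
        simp only [IsWordDesc, not_or, not_not] at h
        rw [h.1]

theorem coTab_wordTab {r : ℕ} [NeZero r] (w : List (Fin r × ℕ)) :
    coTab (wordShape w) w.length (wordTab w) = (wordComp w).reverse := by
  have hsort : (sDesPlusTab (wordShape w) w.length (wordTab w)).sort (· ≤ ·) =
      (partSums (wordComp w)).reverse := by
    rw [sDesPlusTab_wordTab, ← List.toFinset_reverse]
    have hp := pairwise_partSums (wordComp_pos w)
    refine (List.toFinset_sort (· ≤ ·) ?_).2 ?_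
    · exact List.nodup_reverse.2 (hp.imp fun h => h.ne')
    · rw [List.pairwise_reverse]
      exact hp.imp fun h => h.le
  rw [coTab, hsort]
  exact map_range_partSums _ _ (map_tabColor_partSums w)

theorem mem_shOf {r : ℕ} {lam : Fin r → YoungDiagram} {j : Fin r} {c : ℤ × ℤ} :
    c ∈ shOf lam j ↔ 0 ≤ c.1 ∧ 0 ≤ c.2 ∧ c.2 < (lam j).rowLen c.1.toNat := by
  obtain ⟨a, b⟩ := c
  rw [shOf, Finset.mem_image]
  constructor
  · rintro ⟨⟨i, k⟩, h, h'⟩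
    obtain ⟨rfl, rfl⟩ := Prod.mk.inj h'
    rw [YoungDiagram.mem_cells, YoungDiagram.mem_iff_lt_rowLen] at h
    simpa using h
  · rintro ⟨h1, h2, h3⟩
    lift a to ℕ using h1
    lift b to ℕ using h2
    refine ⟨(a, b), ?_, rfl⟩
    rw [YoungDiagram.mem_cells, YoungDiagram.mem_iff_lt_rowLen]
    simpa using h3

theorem isYoungShape_shOf {r : ℕ} (lam : Fin r → YoungDiagram) : IsYoungShape (shOf lam) := by
  intro j c hc
  rw [mem_shOf] at hc
  refine ⟨hc.1, hc.2.1, fun h => ?_, fun h => ?_⟩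
  · rw [mem_shOf]
    refine ⟨by simp only; omega, hc.2.1, hc.2.2.trans_le ?_⟩
    exact Nat.cast_le.2 ((lam j).rowLen_anti _ _ (by simp only; omega))
  · rw [mem_shOf]
    exact ⟨hc.1, by simp only; omega, by have := hc.2.2; simp only; omega⟩

theorem shOf_eq_wordShape_iff {r : ℕ} {lam : Fin r → YoungDiagram} {w : List (Fin r × ℕ)} :
    shOf lam = wordShape w ↔ ∀ j i, (lam j).rowLen i = w.count (j, i) := by
  constructor
  · intro h j i
    refine eq_of_forall_lt_iff fun m => ?_
    have := congrArg (fun s => ((i : ℤ), (m : ℤ)) ∈ s j) h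
    simpa [mem_shOf, mem_wordShape] using this
  · intro h
    funext j
    ext c
    rw [mem_shOf, mem_wordShape, h]

theorem youngDiagram_eq_of_rowLen {μ ν : YoungDiagram} (h : ∀ i, μ.rowLen i = ν.rowLen i) :
    μ = ν := by
  ext ⟨i, j⟩
  rw [YoungDiagram.mem_cells, YoungDiagram.mem_cells, YoungDiagram.mem_iff_lt_rowLen,
    YoungDiagram.mem_iff_lt_rowLen, h]

theorem exists_rowLen_eq_count {r : ℕ} {w : List (Fin r × ℕ)} (hw : IsLatticeWord w) :
    ∃ lam : Fin r → YoungDiagram, ∀ j i, (lam j).rowLen i = w.count (j, i) := by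
  have hmem : ∀ j (c : ℕ × ℕ), c ∈ (wordShape w j).image (fun c => (c.1.toNat, c.2.toNat)) ↔
      c.2 < w.count (j, c.1) := by
    rintro j ⟨a, b⟩
    rw [Finset.mem_image]
    constructor
    · rintro ⟨c, hc, h⟩
      rw [mem_wordShape] at hc
      obtain ⟨rfl, rfl⟩ := Prod.mk.inj h
      simp only
      omega
    · intro h
      exact ⟨((a : ℤ), (b : ℤ)), by simpa [mem_wordShape] using h, by simp⟩
  have hanti : ∀ j, Antitone fun i => w.count (j, i) := fun j =>
    antitone_nat_of_succ_le (hw.count_succ_le j)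
  refine ⟨fun j => ⟨(wordShape w j).image (fun c => (c.1.toNat, c.2.toNat)), ?_⟩, fun j i => ?_⟩
  · rintro c d hdc hc
    rw [Finset.mem_coe, hmem] at hc ⊢
    exact hdc.2.trans_lt (hc.trans_le (hanti j hdc.1))
  · refine eq_of_forall_lt_iff fun m => ?_
    rw [← YoungDiagram.mem_iff_lt_rowLen, ← YoungDiagram.mem_cells]
    exact hmem j (i, m)

open Classical in
/-- The tuple of Young diagrams whose row lengths count the letters of a lattice word. -/
noncomputable def wordDiagram {r : ℕ} (w : List (Fin r × ℕ)) : Fin r → YoungDiagram :=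
  if hw : IsLatticeWord w then (exists_rowLen_eq_count hw).choose else fun _ => ⊥

theorem rowLen_wordDiagram {r : ℕ} {w : List (Fin r × ℕ)} (hw : IsLatticeWord w) (j : Fin r)
    (i : ℕ) : (wordDiagram w j).rowLen i = w.count (j, i) := by
  rw [wordDiagram, dif_pos hw]
  exact (exists_rowLen_eq_count hw).choose_spec j i

theorem wordDiagram_eq_iff {r : ℕ} {w : List (Fin r × ℕ)} (hw : IsLatticeWord w)
    {lam : Fin r → YoungDiagram} : wordDiagram w = lam ↔ shOf lam = wordShape w := by
  rw [shOf_eq_wordShape_iff]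
  constructor
  · rintro rfl
    exact rowLen_wordDiagram hw
  · intro h
    funext j
    exact youngDiagram_eq_of_rowLen fun i => by rw [rowLen_wordDiagram hw, h]

theorem card_shOf {r : ℕ} (lam : Fin r → YoungDiagram) (j : Fin r) :
    (shOf lam j).card = (lam j).card := by
  refine Finset.card_image_of_injective _ fun c d h => ?_
  simpa [Prod.ext_iff] using h

theorem sum_card_wordDiagram {r : ℕ} {w : List (Fin r × ℕ)} (hw : IsLatticeWord w) :
    ∑ j, (wordDiagram w j).card = w.length := by
  rw [← sum_card_wordShape w, ← (wordDiagram_eq_iff hw).1 rfl]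
  exact Finset.sum_congr rfl fun j _ => (card_shOf _ j).symm

open Classical in
theorem ncard_tableaux_eq {r : ℕ} [NeZero r] (lam : Fin r → YoungDiagram) (n : ℕ)
    (l : List (ℕ × Fin r)) (hsum : (l.map Prod.fst).sum = n) :
    {T : Fin r → ℤ × ℤ → ℕ |
        IsPartiteSYT (shOf lam) n T ∧ coTab (shOf lam) n T = l}.ncard =
      ((compWords l.reverse).filter fun w => wordDiagram w = lam).card := by
  have hlen : ∀ w ∈ compWords l.reverse, w.length = n := by
    intro w hw
    rw [mem_compWords] at hw
    rw [← wordComp_sum w, hw.2, List.map_reverse, List.sum_reverse, hsum]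
  have himage : {T : Fin r → ℤ × ℤ → ℕ |
      IsPartiteSYT (shOf lam) n T ∧ coTab (shOf lam) n T = l} =
      wordTab '' ((compWords l.reverse).filter fun w => wordDiagram w = lam : Finset _) := by
    ext T
    rw [Set.mem_image]
    constructor
    · rintro ⟨h1, h2⟩
      obtain ⟨w, hw, hwn, hws, rfl⟩ := exists_wordTab n _ T (isYoungShape_shOf lam) h1
      rw [← hws, ← hwn, coTab_wordTab] at h2
      refine ⟨w, ?_, rfl⟩
      rw [Finset.mem_coe, Finset.mem_filter, mem_compWords, wordDiagram_eq_iff hw]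
      exact ⟨⟨hw, by rw [← h2, List.reverse_reverse]⟩, hws.symm⟩
    · rintro ⟨w, hw, rfl⟩
      rw [Finset.mem_coe, Finset.mem_filter] at hw
      have hn := hlen w hw.1
      have hc := (mem_compWords.1 hw.1)
      have hs := (wordDiagram_eq_iff hc.1).1 hw.2
      refine ⟨?_, ?_⟩
      · rw [hs, ← hn]
        exact isPartiteSYT_wordTab hc.1
      · rw [hs, ← hn, coTab_wordTab, hc.2, List.reverse_reverse]
  rw [himage, Set.InjOn.ncard_image, Set.ncard_coe_finset]
  intro w hw w' hw' h
  rw [Finset.mem_coe, Finset.mem_filter] at hw hw'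
  exact wordTab_injective ((hlen w hw.1).trans (hlen w' hw'.1).symm) h

theorem blk_cons (a : ℕ) (β : List ℕ) (i : ℕ) :
    blk (a :: β) i = if i < a then 0 else blk β (i - a) + 1 := by
  rw [blk, List.length_cons, List.range_succ_eq_map, List.filter_cons, List.filter_map,
    apply_ite List.length]
  by_cases h : i < a
  · rw [if_pos h, if_neg (by simpa using h), List.length_map, List.length_eq_zero_iff,
      List.filter_eq_nil_iff]
    intro k _
    rw [Function.comp_apply, List.take_succ_cons, List.sum_cons, decide_eq_true_iff]
    omega
  · rw [if_neg h, if_pos (by simpa using h), List.length_cons, List.length_map, blk]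
    congr 3
    funext k
    rw [Function.comp_apply, List.take_succ_cons, List.sum_cons, decide_eq_decide]
    omega

theorem blk_lt_length {β : List ℕ} {i : ℕ} (hi : i < β.sum) : blk β i < β.length := by
  induction β generalizing i with
  | nil => simp at hi
  | cons a β ih =>
    rw [blk_cons]
    split_ifs with h
    · simp
    · rw [List.sum_cons] at hi
      simpa using ih (i := i - a) (by omega)

theorem sum_blk_eq (β : List ℕ) (k : ℕ) :
    (∑ i ∈ Finset.range β.sum, if blk β i = k then 1 else 0) = β.getD k 0 := by
  induction β generalizing k with
  | nil => simp
  | cons a β ih =>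
    rw [List.sum_cons, Finset.sum_range_add]
    have h1 : ∀ i ∈ Finset.range a, (if blk (a :: β) i = k then 1 else 0) =
        if k = 0 then 1 else 0 := by
      intro i hi
      rw [blk_cons, if_pos (Finset.mem_range.1 hi)]
      simp only [eq_comm]
    have h2 : ∀ i, blk (a :: β) (a + i) = blk β i + 1 := by
      intro i
      rw [blk_cons, if_neg (by omega), Nat.add_sub_cancel_left]
    rw [Finset.sum_congr rfl h1]
    simp only [h2]
    cases k with
    | zero => simp
    | succ k => simpa using ih k

/-- Block indices of the positions of a composition of `n`. -/
def blkFin {n : ℕ} (β : List ℕ) (h : β.sum = n) (i : Fin n) : Fin β.length :=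
  ⟨blk β i, blk_lt_length (h ▸ i.2)⟩

theorem card_blkFin_fiber {n : ℕ} (β : List ℕ) (h : β.sum = n) (k : Fin β.length) :
    Fintype.card {i : Fin n // blkFin β h i = k} = β.get k := by
  subst h
  have := sum_blk_eq β k
  rw [Finset.sum_range] at this
  rw [Fintype.card_subtype, Finset.card_filter]
  simp only [blkFin, Fin.ext_iff]
  rw [this]
  simp

theorem inducedChar_eq_of_conj {G : Type*} [Group G] [Fintype G] {H H' : Set G} {χ χ' : G → ℂ}
    (t : G) (hH : ∀ w, w ∈ H' ↔ t⁻¹ * w * t ∈ H) (hχ : ∀ w, χ' w = χ (t⁻¹ * w * t)) :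
    inducedChar H' χ' = inducedChar H χ := by
  funext g
  rw [inducedChar, inducedChar]
  have hcard : Nat.card H' = Nat.card H := by
    refine Nat.card_congr ((MulAut.conj t⁻¹).toEquiv.subtypeEquiv fun w => ?_)
    rw [hH]
    simp
  rw [hcard]
  congr 1
  refine Fintype.sum_equiv (Equiv.mulRight t) _ _ fun x => ?_
  have hx : t⁻¹ * (x⁻¹ * g * x) * t = (x * t)⁻¹ * g * (x * t) := by group
  rw [Equiv.coe_mulRight, hχ, hx]
  have hiff : x⁻¹ * g * x ∈ H' ↔ (x * t)⁻¹ * g * (x * t) ∈ H := by rw [hH, hx]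
  by_cases hm : (x * t)⁻¹ * g * (x * t) ∈ H
  · rw [if_pos hm, if_pos (hiff.2 hm)]
  · rw [if_neg hm, if_neg (mt hiff.1 hm)]

theorem exists_equiv_get_eq {α : Type*} {l l' : List α} (h : l.Perm l') :
    ∃ e : Fin l.length ≃ Fin l'.length, ∀ i, l.get i = l'.get (e i) := by
  classical
  have hcard : ∀ a, Nonempty ({i : Fin l.length // l.get i = a} ≃
      {i : Fin l'.length // l'.get i = a}) := by
    intro a
    rw [← Fintype.card_eq, Fintype.card_subtype, Fintype.card_subtype]
    have key : ∀ m : List α, (Finset.univ.filter fun i : Fin m.length => m.get i = a).card =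
        m.count a := by
      intro m
      have := Fin.card_filter_univ_eq_vector_get_eq_count a (⟨m, rfl⟩ : List.Vector α m.length)
      simpa [List.Vector.get, eq_comm] using this
    rw [key, key, h.count_eq]
  let e := fun a => (hcard a).some
  exact ⟨Equiv.ofFiberEquiv e, fun i => (Equiv.ofFiberEquiv_map e i).symm⟩

theorem left_conj_inr {n r : ℕ} (τ : Equiv.Perm (Fin n)) (w : Gnr n r) (i : Fin n) :
    ((SemidirectProduct.inr τ)⁻¹ * w * SemidirectProduct.inr τ : Gnr n r).left i =
      w.left (τ i) := by
  rw [← map_inv, SemidirectProduct.mul_left, SemidirectProduct.mul_left,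
    SemidirectProduct.left_inr, SemidirectProduct.left_inr, SemidirectProduct.right_inr, map_one,
    one_mul, mul_one]
  rfl

theorem inducedChar_perm {n r : ℕ} [NeZero r] {b b' : List (ℕ × Fin r)} (h : b.Perm b')
    (hsum : (b.map Prod.fst).sum = n) :
    inducedChar (youngSet n r (b.map Prod.fst)) (oneChar n r b) =
      inducedChar (youngSet n r (b'.map Prod.fst)) (oneChar n r b') := by
  have hsum' : (b'.map Prod.fst).sum = n := by rw [← hsum, (h.map _).sum_eq]
  obtain ⟨e, he⟩ := exists_equiv_get_eq h
  have hfib : ∀ k : Fin b'.length, Nonempty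
      ({i : Fin n // e (Fin.cast (List.length_map _) (blkFin _ hsum i)) = k} ≃
        {i : Fin n // Fin.cast (List.length_map _) (blkFin _ hsum' i) = k}) := by
    intro k
    have h1 := card_blkFin_fiber _ hsum (Fin.cast (List.length_map _).symm (e.symm k))
    have h2 := card_blkFin_fiber _ hsum' (Fin.cast (List.length_map _).symm k)
    have h3 := he (e.symm k)
    rw [e.apply_symm_apply] at h3
    rw [← Fintype.card_eq]
    calc _ = Fintype.card {i : Fin n //
          blkFin _ hsum i = Fin.cast (List.length_map _).symm (e.symm k)} := by
          refine Fintype.card_congr (Equiv.subtypeEquivRight fun i => ?_)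
          rw [← e.eq_symm_apply, Fin.ext_iff, Fin.ext_iff]
          rfl
      _ = Fintype.card {i : Fin n // blkFin _ hsum' i = Fin.cast (List.length_map _).symm k} := by
          rw [h1, h2]
          simpa using congrArg Prod.fst h3
      _ = _ := by
          refine Fintype.card_congr (Equiv.subtypeEquivRight fun i => ?_)
          rw [Fin.ext_iff, Fin.ext_iff]
          rfl
  let τ : Equiv.Perm (Fin n) := Equiv.ofFiberEquiv fun k => (hfib k).some
  have hτ : ∀ i, Fin.cast (List.length_map _) (blkFin _ hsum' (τ i)) =
      e (Fin.cast (List.length_map _) (blkFin _ hsum i)) :=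
    fun i => Equiv.ofFiberEquiv_map (fun k => (hfib k).some) i
  have hblk : ∀ i k : Fin n, blk (b'.map Prod.fst) (τ i) = blk (b'.map Prod.fst) (τ k) ↔
      blk (b.map Prod.fst) i = blk (b.map Prod.fst) k := by
    intro i k
    have h1 := hτ i
    have h2 := hτ k
    calc _ ↔ Fin.cast (List.length_map _) (blkFin _ hsum' (τ i)) =
          Fin.cast (List.length_map _) (blkFin _ hsum' (τ k)) := by
          rw [Fin.ext_iff]; rfl
      _ ↔ _ := by
          rw [h1, h2, e.apply_eq_iff_eq, Fin.ext_iff]; rfl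
  have hcol : ∀ i : Fin n, b'.getD (blk (b'.map Prod.fst) (τ i)) (1, 0) =
      b.getD (blk (b.map Prod.fst) i) (1, 0) := by
    intro i
    have h1 := he (Fin.cast (List.length_map _) (blkFin _ hsum i))
    rw [← hτ i] at h1
    have hl : blk (b.map Prod.fst) i < b.length := by
      simpa [blkFin] using (blkFin _ hsum i).2
    have hl' : blk (b'.map Prod.fst) (τ i) < b'.length := by
      simpa [blkFin] using (blkFin _ hsum' (τ i)).2
    rw [List.getD_eq_getElem _ _ hl, List.getD_eq_getElem _ _ hl']
    exact h1.symm
  symm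
  have hright : ∀ (w : Gnr n r) (i : Fin n),
      τ (((SemidirectProduct.inr τ)⁻¹ * w * SemidirectProduct.inr τ : Gnr n r).right i) =
        w.right (τ i) := by
    intro w i
    simp
  have hleft : ∀ (w : Gnr n r) (i : Fin n),
      ((SemidirectProduct.inr τ)⁻¹ * w * SemidirectProduct.inr τ : Gnr n r).left i =
        w.left (τ i) := by
    intro w i
    exact left_conj_inr τ w i
  refine inducedChar_eq_of_conj (SemidirectProduct.inr τ : Gnr n r) (fun w => ?_) fun w => ?_
  · simp only [youngSet, Set.mem_ofPred_eq]
    rw [← τ.forall_congr_right]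
    refine forall_congr' fun i => ?_
    rw [← hblk, hright]
  · rw [oneChar, oneChar]
    congr 1
    rw [← Equiv.sum_comp τ]
    refine Finset.sum_congr rfl fun i _ => ?_
    rw [hcol, hleft]

open MvPolynomial in
/-- Formal complete homogeneous symmetric functions: `h_k` in color `j`. -/
noncomputable def formalH (r : ℕ) (j : Fin r) (k : ℤ) : MvPolynomial (ℕ × Fin r) ℂ :=
  if k < 0 then 0 else if k = 0 then 1 else X (k.toNat, j)

/-- The linear map sending the monomial `∏ h_{β_i, δ_i}` to the induction of `1_{(β,δ)}`: the
inverse of the Frobenius characteristic. -/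
noncomputable def frobInv (n r : ℕ) [NeZero r] :
    MvPolynomial (ℕ × Fin r) ℂ →ₗ[ℂ] (Gnr n r → ℂ) :=
  (MvPolynomial.basisMonomials (ℕ × Fin r) ℂ).constr ℂ fun d =>
    inducedChar (youngSet n r ((Finsupp.toMultiset d).toList.map Prod.fst))
      (oneChar n r (Finsupp.toMultiset d).toList)

theorem prod_map_X_eq_monomial {σ : Type*} [DecidableEq σ] (b : List σ) :
    (b.map fun p => (MvPolynomial.X p : MvPolynomial σ ℂ)).prod =
      MvPolynomial.monomial (Multiset.toFinsupp (b : Multiset σ)) 1 := by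
  induction b with
  | nil => simp
  | cons p b ih =>
    rw [List.map_cons, List.prod_cons, ih, MvPolynomial.X, MvPolynomial.monomial_mul, one_mul,
      ← Multiset.cons_coe, ← Multiset.singleton_add, Multiset.toFinsupp_add,
      Multiset.toFinsupp_singleton]

theorem frobInv_prod_X {n r : ℕ} [NeZero r] {b : List (ℕ × Fin r)}
    (hsum : (b.map Prod.fst).sum = n) :
    frobInv n r (b.map fun p => MvPolynomial.X p).prod =
      inducedChar (youngSet n r (b.map Prod.fst)) (oneChar n r b) := by
  have h := (MvPolynomial.basisMonomials (ℕ × Fin r) ℂ).constr_basis ℂ (fun d =>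
    inducedChar (youngSet n r ((Finsupp.toMultiset d).toList.map Prod.fst))
      (oneChar n r (Finsupp.toMultiset d).toList)) (Multiset.toFinsupp (b : Multiset (ℕ × Fin r)))
  rw [MvPolynomial.coe_basisMonomials] at h
  rw [prod_map_X_eq_monomial, frobInv, h, Multiset.toFinsupp_toMultiset]
  have hperm : b.Perm (b : Multiset (ℕ × Fin r)).toList := by
    rw [← Multiset.coe_eq_coe, Multiset.coe_toList]
  exact (inducedChar_perm hperm hsum).symm

theorem formalH_natCast {r : ℕ} (j : Fin r) {k : ℕ} (hk : 0 < k) :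
    formalH r j k = MvPolynomial.X (k, j) := by
  rw [formalH, if_neg (by omega), if_neg (by omega), Int.toNat_natCast]

theorem prod_map_formalH {r : ℕ} (L : List (ℤ × Fin r)) :
    (L.map fun p => formalH r p.2 p.1).prod =
      if ∀ p ∈ L, 0 ≤ p.1 then
        (((L.filter fun p => decide (p.1 ≠ 0)).map fun p => (p.1.toNat, p.2)).map fun p =>
          MvPolynomial.X p).prod
      else 0 := by
  induction L with
  | nil => simp
  | cons p L ih =>
    rw [List.map_cons, List.prod_cons, ih, formalH, List.filter_cons]
    by_cases hL : ∀ q ∈ L, 0 ≤ q.1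
    · rw [if_pos hL]
      rcases lt_trichotomy p.1 0 with h | h | h
      · rw [if_pos h, zero_mul, if_neg fun h' => h.not_ge (h' p (by simp))]
      · rw [if_pos (List.forall_mem_cons (p := fun q : ℤ × Fin r => 0 ≤ q.1) |>.2 ⟨h.ge, hL⟩)]
        simp [h]
      · rw [if_pos (List.forall_mem_cons (p := fun q : ℤ × Fin r => 0 ≤ q.1) |>.2 ⟨h.le, hL⟩),
          if_neg h.not_gt, if_neg h.ne']
        simp [h.ne']
    · rw [if_neg hL, mul_zero, if_neg fun h' => hL (List.forall_mem_cons.1 h').2]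

theorem sum_filter_toNat {r : ℕ} (L : List (ℤ × Fin r)) (hL : ∀ p ∈ L, 0 ≤ p.1) :
    (((((L.filter fun p => decide (p.1 ≠ 0)).map fun p => (p.1.toNat, p.2)).map
      Prod.fst).sum : ℕ) : ℤ) =
      (L.map Prod.fst).sum := by
  induction L with
  | nil => simp
  | cons p L ih =>
    rw [List.forall_mem_cons] at hL
    have ih := ih hL.2
    rw [List.filter_cons]
    split_ifs with h
    · simp only [List.map_cons, List.sum_cons, Nat.cast_add, ih]
      have := hL.1
      omega
    · simp only [List.map_cons, List.sum_cons, ih]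
      simp at h
      omega

theorem sum_rowLen_eq_card (μ : YoungDiagram) :
    ∑ i : Fin (μ.colLen 0), μ.rowLen i = μ.card := by
  rw [Fin.sum_univ_eq_sum_range fun i => μ.rowLen i, YoungDiagram.card,
    Finset.card_eq_sum_card_fiberwise (f := Prod.fst) (t := Finset.range (μ.colLen 0))]
  · refine Finset.sum_congr rfl fun i _ => ?_
    rw [YoungDiagram.rowLen_eq_card]
    rfl
  · intro c hc
    rw [Finset.coe_range, Set.mem_Iio, ← YoungDiagram.mem_iff_lt_colLen]
    exact μ.up_left_mem le_rfl (Nat.zero_le _) hc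

theorem colLen_le_card (μ : YoungDiagram) : μ.colLen 0 ≤ μ.card := by
  rw [YoungDiagram.colLen_eq_card]
  exact Finset.card_le_card (Finset.filter_subset _ _)

theorem sum_jtList {r : ℕ} (lam : Fin r → YoungDiagram)
    (σ : ∀ j : Fin r, Equiv.Perm (Fin ((lam j).colLen 0))) :
    ((jtList lam σ).map Prod.fst).sum = ∑ j, ((lam j).card : ℤ) := by
  rw [jtList, List.map_flatten, List.sum_flatten, List.map_map, List.map_map, ← List.ofFn_eq_map,
    List.sum_ofFn]
  refine Finset.sum_congr rfl fun j _ => ?_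
  rw [Function.comp_apply, Function.comp_apply, List.map_map, ← List.ofFn_eq_map, List.sum_ofFn,
    ← sum_rowLen_eq_card]
  simp only [Function.comp_apply, Finset.sum_sub_distrib, Finset.sum_add_distrib]
  rw [Equiv.sum_comp (σ j) fun i => ((i : ℕ) : ℤ)]
  simp

theorem prod_map_jtList {r : ℕ} {R : Type*} [CommRing R] (h : Fin r → ℤ → R)
    (lam : Fin r → YoungDiagram) (σ : ∀ j : Fin r, Equiv.Perm (Fin ((lam j).colLen 0))) :
    ((jtList lam σ).map fun p => h p.2 p.1).prod =
      ∏ j, ∏ i : Fin ((lam j).colLen 0),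
        h j (((lam j).rowLen i : ℤ) + ((σ j i : ℕ) : ℤ) - ((i : ℕ) : ℤ)) := by
  rw [jtList, List.map_flatten, List.prod_flatten, List.map_map, List.map_map, ← List.ofFn_eq_map,
    List.prod_ofFn]
  refine Finset.prod_congr rfl fun j _ => ?_
  rw [Function.comp_apply, Function.comp_apply, List.map_map, ← List.ofFn_eq_map, List.prod_ofFn]
  rfl

theorem frobInv_prod_jtDet {n r : ℕ} [NeZero r] (lam : Fin r → YoungDiagram)
    (hcard : ∑ j, (lam j).card = n) :
    frobInv n r (∏ j, jtDet (formalH r j) fun i : Fin ((lam j).colLen 0) => (lam j).rowLen i) =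
      irrChar n r lam := by
  have hdet : ∀ j, jtDet (formalH r j) (fun i : Fin ((lam j).colLen 0) => (lam j).rowLen i) =
      ∑ σ : Equiv.Perm (Fin ((lam j).colLen 0)), ((Equiv.Perm.sign σ : ℤ) :
        MvPolynomial (ℕ × Fin r) ℂ) * ∏ i : Fin ((lam j).colLen 0),
          formalH r j (((lam j).rowLen i : ℤ) + ((σ i : ℕ) : ℤ) - ((i : ℕ) : ℤ)) := by
    intro j
    rw [jtDet, ← Matrix.det_transpose, Matrix.det_apply']
    refine Finset.sum_congr rfl fun σ _ => ?_
    congr 1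
    refine Finset.prod_congr rfl fun i _ => ?_
    rw [Matrix.transpose_apply, Matrix.of_apply]
    congr 1
    ring
  rw [Finset.prod_congr rfl fun j _ => hdet j, Finset.prod_univ_sum, Fintype.piFinset_univ,
    irrChar, map_sum]
  refine Finset.sum_congr rfl fun σ _ => ?_
  rw [Finset.prod_mul_distrib, ← prod_map_jtList (formalH r), prod_map_formalH,
    ← Int.cast_prod, ← zsmul_eq_mul, map_zsmul]
  split_ifs with h
  · rw [frobInv_prod_X, List.map_map]
    · rfl
    · have := sum_filter_toNat _ h
      rw [sum_jtList] at this
      rw [← hcard]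
      exact_mod_cast this
  · rw [map_zero, smul_zero]

theorem frobInv_wordSchur {n r : ℕ} [NeZero r] {w : List (Fin r × ℕ)} (hw : IsLatticeWord w)
    (hlen : w.length = n) :
    frobInv n r (wordSchur (formalH r) n w) = irrChar n r (wordDiagram w) := by
  have hcard : ∑ j, (wordDiagram w j).card = n := (sum_card_wordDiagram hw).trans hlen
  rw [← frobInv_prod_jtDet _ hcard, wordSchur]
  congr 1
  refine Finset.prod_congr rfl fun j _ => ?_
  rw [← jtDet_stable (formalH r j) (N := n) (by simp [formalH])
    (fun k hk => by rw [formalH, if_pos hk]) (fun i => (wordDiagram w j).rowLen i)]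
  · simp only [rowLen_wordDiagram hw]
  · refine (colLen_le_card _).trans ?_
    rw [← hcard]
    exact Finset.single_le_sum (f := fun j => (wordDiagram w j).card) (fun _ _ => Nat.zero_le _)
      (Finset.mem_univ j)
  · intro i hi
    by_contra h
    have hmem : (i, 0) ∈ wordDiagram w j := YoungDiagram.mem_iff_lt_rowLen.2 (by omega)
    rw [YoungDiagram.mem_iff_lt_colLen] at hmem
    omega

theorem frobInv_ribbonProd {n r : ℕ} [NeZero r] {l : List (ℕ × Fin r)} (hl : ∀ p ∈ l, 0 < p.1)
    (hsum : (l.map Prod.fst).sum = n) :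
    frobInv n r (ribbonProd (formalH r) l) =
      ∑ b ∈ coarsenings l, (-1 : ℂ) ^ (l.length - b.length) •
        inducedChar (youngSet n r (b.map Prod.fst)) (oneChar n r b) := by
  rw [← sum_coarsenings _ l hl, map_sum]
  refine Finset.sum_congr rfl fun b hb => ?_
  rw [mem_coarsenings hl] at hb
  have hprod : (b.map fun p => formalH r p.2 p.1).prod = (b.map fun p => MvPolynomial.X p).prod :=
    congrArg List.prod (List.map_congr_left fun p hp => formalH_natCast p.2 (hb.1 p hp))
  have hneg : (-1 : MvPolynomial (ℕ × Fin r) ℂ) ^ (l.length - b.length) =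
      MvPolynomial.C ((-1 : ℂ) ^ (l.length - b.length)) := by simp
  rw [hprod, hneg, ← MvPolynomial.smul_eq_C_mul, map_smul,
    frobInv_prod_X ((sum_eq_of_coarserC hb.2).trans hsum)]

open Classical in
theorem finsum_smul_irrChar {n r : ℕ} [NeZero r] {l : List (ℕ × Fin r)}
    (hsum : (l.map Prod.fst).sum = n) :
    (∑ᶠ (lam : Fin r → YoungDiagram) (_ : ∑ j, (lam j).card = n),
        (({T : Fin r → ℤ × ℤ → ℕ |
            IsPartiteSYT (shOf lam) n T ∧ coTab (shOf lam) n T = l}.ncard : ℂ)) •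
          irrChar n r lam) =
      ∑ w ∈ compWords l.reverse, irrChar n r (wordDiagram w) := by
  rw [Finset.sum_comp (irrChar n r) wordDiagram, ← finsum_mem_coe_finset]
  refine finsum_congr fun lam => ?_
  rw [finsum_eq_if, finsum_eq_if, ncard_tableaux_eq lam n l hsum, Nat.cast_smul_eq_nsmul]
  by_cases hlam : lam ∈ (compWords l.reverse).image wordDiagram
  · rw [if_pos (Finset.mem_coe.2 hlam), if_pos]
    obtain ⟨w, hw, rfl⟩ := Finset.mem_image.1 hlam
    rw [sum_card_wordDiagram (mem_compWords.1 hw).1, length_of_mem_compWords hw,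
      List.map_reverse, List.sum_reverse, hsum]
  · rw [if_neg (mt Finset.mem_coe.1 hlam), Finset.filter_eq_empty_iff.2, Finset.card_empty,
      zero_smul, ite_self]
    intro w hw h
    exact hlam (Finset.mem_image.2 ⟨w, hw, h⟩)

/-- For every `r`-colored composition `(α,ε)` of `n` (given
as the list `l` of colored parts), the virtual character
`Σ_{(β,δ) ⪯ (α,ε)} (-1)^{ℓ(α)-ℓ(β)} Ind_{S_{β,r}}^{S_{n,r}} 1_{(β,δ)}`
of the colored permutation group `S_{n,r}` equals
`Σ_{𝛌 ⊢ n} c_𝛌(α,ε) χ^𝛌`, where `χ^𝛌` is the irreducible character of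
`S_{n,r}` indexed by the `r`-partite partition `𝛌` and `c_𝛌(α,ε)` is the
number of standard Young `r`-partite tableaux of shape `𝛌` with colored
descent composition `(α,ε)`; in particular it is a genuine (non-virtual)
character. -/
theorem statement16 (n r : ℕ) (hn : 0 < n) [NeZero r] (l : List (ℕ × Fin r))
    (hpos : ∀ p ∈ l, 0 < p.1) (hsum : (l.map Prod.fst).sum = n) :
    (∑ᶠ (b : List (ℕ × Fin r))
        (_ : (∀ p ∈ b, 0 < p.1) ∧ (b.map Prod.fst).sum = n ∧ coarserC b l),
        (-1 : ℂ) ^ (l.length - b.length) •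
          inducedChar (youngSet n r (b.map Prod.fst)) (oneChar n r b)) =
      ∑ᶠ (lam : Fin r → YoungDiagram) (_ : ∑ j, (lam j).card = n),
        (({T : Fin r → ℤ × ℤ → ℕ |
            IsPartiteSYT (shOf lam) n T ∧ coTab (shOf lam) n T = l}.ncard : ℂ)) •
          irrChar n r lam := by
  have hiff : ∀ b : List (ℕ × Fin r),
      ((∀ p ∈ b, 0 < p.1) ∧ (b.map Prod.fst).sum = n ∧ coarserC b l) ↔
        b ∈ (coarsenings l : Set (List (ℕ × Fin r))) := by
    intro b
    rw [Finset.mem_coe, mem_coarsenings hpos]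
    exact ⟨fun h => ⟨h.1, h.2.2⟩, fun h => ⟨h.1, (sum_eq_of_coarserC h.2).trans hsum, h.2⟩⟩
  have hsum' : (l.reverse.map Prod.fst).sum = n := by
    rw [List.map_reverse, List.sum_reverse, hsum]
  have hne : l.reverse ≠ [] := by
    intro h
    rw [h] at hsum'
    simp at hsum'
    omega
  rw [finsum_congr fun b => finsum_congr_Prop (propext (hiff b)) fun _ => rfl,
    finsum_mem_coe_finset, ← frobInv_ribbonProd hpos hsum, finsum_smul_irrChar hsum]
  conv_lhs => rw [← List.reverse_reverse l]
  rw [← compSchur_eq_ribbonProd (formalH r) (fun j => by simp [formalH])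
    (fun j k hk => by rw [formalH, if_pos hk]) l.reverse hne (by simpa using hpos) hsum'.le,
    compSchur, map_sum]
  exact Finset.sum_congr rfl fun w hw => frobInv_wordSchur (mem_compWords.1 hw).1
    ((length_of_mem_compWords hw).trans hsum')
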